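/- arXiv:1908.00199 — 12 statements merged into one kernel-verified Lean document; each statement's English description precedes it below -/
import Mathlib

section
/- Let A be an element of SL(2,ℝ) with trace 0, and suppose A fixes a point z₀ of the upper half-plane ℍ under the Möbius action. Then for every z ∈ ℍ one has dist(z, A • z) = 2 · dist(z, z₀); that is, A acts on ℍ as the point reflection (rotation by π) about z₀. -/
open Matrix MatrixGroups UpperHalfPlane

theorem smul_real_eqs (A : SL(2, ℝ)) (hd : A 1 1 = - A 0 0) (z : ℍ) :
    (A • z).re * (A 1 0 * z.re - A 0 0) - (A • z).im * (A 1 0 * z.im) = A 0 0 * z.re + A 0 1 ∧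
    (A • z).re * (A 1 0 * z.im) + (A • z).im * (A 1 0 * z.re - A 0 0) = A 0 0 * z.im := by
  have hne : ((A 1 0 : ℝ) : ℂ) * (z : ℂ) + ((A 1 1 : ℝ) : ℂ) ≠ 0 :=
    UpperHalfPlane.denom_ne_zero (A : GL (Fin 2) ℝ) z
  have h : ((A • z : ℍ) : ℂ) * (((A 1 0 : ℝ) : ℂ) * (z : ℂ) + ((A 1 1 : ℝ) : ℂ))
      = ((A 0 0 : ℝ) : ℂ) * (z : ℂ) + ((A 0 1 : ℝ) : ℂ) := by
    rw [UpperHalfPlane.coe_specialLinearGroup_apply]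
    exact div_mul_cancel₀ _ hne
  rw [hd] at h
  have h1 := congrArg Complex.re h
  have h2 := congrArg Complex.im h
  simp at h1 h2
  constructor <;> linarith

theorem involution_is_point_reflection
    (A : SL(2, ℝ)) (hA : Matrix.trace (A : Matrix (Fin 2) (Fin 2) ℝ) = 0)
    (z₀ : ℍ) (hz₀ : A • z₀ = z₀) (z : ℍ) :
    dist z (A • z) = 2 * dist z z₀ := by
  have hd : A 1 1 = - A 0 0 := by
    rw [Matrix.trace_fin_two] at hA
    linarith
  have hdet := A.det_coe
  rw [Matrix.det_fin_two] at hdet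
  obtain ⟨e1, e2⟩ := smul_real_eqs A hd z₀
  obtain ⟨f1, f2⟩ := smul_real_eqs A hd z
  rw [hz₀] at e1 e2
  have key : Real.cosh (dist z (A • z)) = Real.cosh (2 * dist z z₀) := by
    rw [Real.cosh_two_mul, Real.sinh_sq, UpperHalfPlane.cosh_dist', UpperHalfPlane.cosh_dist']
    have hy := z.im_pos
    have hy0 := z₀.im_pos
    rw [hd] at hdet
    generalize (A • z).re = X at *
    generalize (A • z).im = Y at *
    generalize z.re = x at *
    generalize z.im = y at *
    generalize z₀.re = p at *
    generalize z₀.im = q at *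
    generalize A 0 0 = a at *
    generalize A 0 1 = b at *
    generalize A 1 0 = c at *
    have ha : a = c * p := by
      apply mul_left_cancel₀ hy0.ne'
      linarith
    subst ha
    have hb : b = - c * (p ^ 2 + q ^ 2) := by linarith
    subst hb
    have hc : c ≠ 0 := by
      rintro rfl
      norm_num at hdet
    have g1 : (X - p) * (x - p) - Y * y = - q ^ 2 := by
      apply mul_left_cancel₀ hc
      linarith
    have g2 : (X - p) * y + Y * (x - p) = 0 := by
      apply mul_left_cancel₀ hc
      linarith
    have hN : 0 < (x - p) ^ 2 + y ^ 2 := by positivity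
    have hX : X = p - q ^ 2 * (x - p) / ((x - p) ^ 2 + y ^ 2) := by
      field_simp
      linear_combination (x - p) * g1 + y * g2
    have hY : Y = q ^ 2 * y / ((x - p) ^ 2 + y ^ 2) := by
      field_simp
      linear_combination (x - p) * g2 - y * g1
    subst hX hY
    field_simp
    ring
  have h2 := Real.cosh_abs (dist z (A • z))
  exact Real.cosh_strictMonoOn.injOn (Set.mem_Ici.2 dist_nonneg)
    (Set.mem_Ici.2 (by positivity)) key
end

section
/- Let A₁, A₂ ∈ SL(2,ℝ) both have trace 0, and suppose A₁ fixes z₁ ∈ ℍ and A₂ fixes z₂ ∈ ℍ with z₁ ≠ z₂. Then the product A₁A₂ is a hyperbolic isometry; concretely, |tr(A₁A₂)| > 2. -/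
open Matrix MatrixGroups UpperHalfPlane

lemma fixed_entries (A : SL(2, ℝ)) (hA : Matrix.trace (A : Matrix (Fin 2) (Fin 2) ℝ) = 0)
    (z : ℍ) (hz : A • z = z) :
    A.1 0 0 = A.1 1 0 * z.re ∧ A.1 1 1 = -(A.1 1 0 * z.re) ∧
      A.1 0 1 = -(A.1 1 0 * (z.re ^ 2 + z.im ^ 2)) ∧ |A.1 1 0| * z.im = 1 := by
  have hdet := A.2
  rw [Matrix.det_fin_two] at hdet
  rw [Matrix.trace_fin_two] at hA
  have h := congrArg (fun w : ℍ => (w : ℂ)) hz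
  simp only [coe_specialLinearGroup_apply] at h
  have hy := z.im_pos
  have hne : ((algebraMap ℝ ℝ (A 1 0) : ℂ) * z + (algebraMap ℝ ℝ (A 1 1) : ℂ)) ≠ 0 := by
    intro h0
    rw [h0, div_zero] at h
    exact z.ne_zero h.symm
  rw [div_eq_iff hne] at h
  have hre := congrArg Complex.re h
  have him := congrArg Complex.im h
  simp at hre him
  have hd : A.1 1 1 = -A.1 0 0 := by linarith
  change A.1 0 0 * z.re + A.1 0 1 = z.re * (A.1 1 0 * z.re + A.1 1 1) - z.im * (A.1 1 0 * z.im) at hre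
  change A.1 0 0 * z.im = z.re * (A.1 1 0 * z.im) + z.im * (A.1 1 0 * z.re + A.1 1 1) at him
  rw [hd] at hre him hdet
  have ha : A.1 0 0 = A.1 1 0 * z.re := by
    apply mul_right_cancel₀ hy.ne'
    linarith
  have hb : A.1 0 1 = -(A.1 1 0 * (z.re ^ 2 + z.im ^ 2)) := by
    rw [ha] at hre
    linarith
  refine ⟨ha, by rw [hd, ha], hb, ?_⟩
  rw [ha, hb] at hdet
  have h2 : (A.1 1 0 * z.im) ^ 2 = 1 := by linarith
  rw [← abs_of_pos hy, ← abs_mul]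
  exact (pow_eq_one_iff_of_nonneg (abs_nonneg _) two_ne_zero).1 (by rw [sq_abs, h2])

theorem product_of_involutions_is_hyperbolic
    (A₁ A₂ : SL(2, ℝ))
    (hA₁ : Matrix.trace (A₁ : Matrix (Fin 2) (Fin 2) ℝ) = 0)
    (hA₂ : Matrix.trace (A₂ : Matrix (Fin 2) (Fin 2) ℝ) = 0)
    (z₁ z₂ : ℍ) (hz₁ : A₁ • z₁ = z₁) (hz₂ : A₂ • z₂ = z₂) (hne : z₁ ≠ z₂) :
    2 < |Matrix.trace ((A₁ * A₂ : SL(2, ℝ)) : Matrix (Fin 2) (Fin 2) ℝ)| := by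
  obtain ⟨a1, d1, b1, c1⟩ := fixed_entries A₁ hA₁ z₁ hz₁
  obtain ⟨a2, d2, b2, c2⟩ := fixed_entries A₂ hA₂ z₂ hz₂
  have hy1 := z₁.im_pos
  have hy2 := z₂.im_pos
  have hS : 0 < (z₁.re - z₂.re) ^ 2 + (z₁.im - z₂.im) ^ 2 := by
    by_contra hcon
    have e1 : z₁.re - z₂.re = 0 := by
      nlinarith [sq_nonneg (z₁.re - z₂.re), sq_nonneg (z₁.im - z₂.im)]
    have e2 : z₁.im - z₂.im = 0 := by
      nlinarith [sq_nonneg (z₁.re - z₂.re), sq_nonneg (z₁.im - z₂.im)]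
    exact hne (UpperHalfPlane.ext (Complex.ext (sub_eq_zero.1 e1) (sub_eq_zero.1 e2)))
  have htr : Matrix.trace ((A₁ * A₂ : SL(2, ℝ)) : Matrix (Fin 2) (Fin 2) ℝ) =
      -(A₁.1 1 0 * A₂.1 1 0 * ((z₁.re - z₂.re) ^ 2 + z₁.im ^ 2 + z₂.im ^ 2)) := by
    rw [Matrix.SpecialLinearGroup.coe_mul, Matrix.trace_fin_two, Matrix.mul_apply,
      Matrix.mul_apply, Fin.sum_univ_two, Fin.sum_univ_two, a1, d1, b1, a2, d2, b2]
    ring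
  rw [htr, abs_neg, abs_mul, abs_mul,
    abs_of_nonneg (by positivity : 0 ≤ (z₁.re - z₂.re) ^ 2 + z₁.im ^ 2 + z₂.im ^ 2)]
  have p1 : 0 < |A₁.1 1 0| := by
    by_contra hc
    nlinarith
  have p2 : 0 < |A₂.1 1 0| := by
    by_contra hc
    nlinarith
  calc (2 : ℝ) = 2 * (|A₁.1 1 0| * z₁.im) * (|A₂.1 1 0| * z₂.im) := by rw [c1, c2]; norm_num
    _ = |A₁.1 1 0| * |A₂.1 1 0| * (2 * z₁.im * z₂.im) := by ring
    _ < _ := by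
      apply mul_lt_mul_of_pos_left _ (mul_pos p1 p2)
      linarith
end

section
/- Let A₁, A₂ ∈ SL(2,ℝ) both have trace 0, and suppose A₁ fixes z₁ ∈ ℍ and A₂ fixes z₂ ∈ ℍ with z₁ ≠ z₂. Then the translation length of the product A₁A₂ equals twice the distance between the fixed points: the infimum over z ∈ ℍ of dist((A₁A₂) • z, z) equals 2 · dist(z₁, z₂). -/
open Matrix MatrixGroups UpperHalfPlane

lemma smul_coords (M : SL(2, ℝ)) (z : ℍ) :
    (M • z).re * (M 1 0 * z.re + M 1 1) - (M • z).im * (M 1 0 * z.im) = M 0 0 * z.re + M 0 1 ∧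
    (M • z).re * (M 1 0 * z.im) + (M • z).im * (M 1 0 * z.re + M 1 1) = M 0 0 * z.im := by
  have hden : ((M 1 0 : ℝ) : ℂ) * z + ((M 1 1 : ℝ) : ℂ) ≠ 0 := by
    have := UpperHalfPlane.denom_ne_zero (M : GL (Fin 2) ℝ) z
    simpa [UpperHalfPlane.denom] using this
  have h := UpperHalfPlane.coe_specialLinearGroup_apply M z
  simp only [Algebra.algebraMap_self, RingHom.id_apply] at h
  rw [eq_div_iff hden] at h
  have h1 := congrArg Complex.re h
  have h2 := congrArg Complex.im h
  simp at h1 h2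
  constructor <;> linarith

lemma cosh_dist_smul (M : SL(2, ℝ)) (z : ℍ) :
    Real.cosh (dist (M • z) z) = (M 0 0 + M 1 1) ^ 2 / 2 - 1 +
      (M 1 0 * (z.re ^ 2 + z.im ^ 2) + (M 1 1 - M 0 0) * z.re - M 0 1) ^ 2 / (2 * z.im ^ 2) := by
  obtain ⟨h1, h2⟩ := smul_coords M z
  have hdet : M 0 0 * M 1 1 - M 0 1 * M 1 0 = 1 := by
    have := M.det_coe
    rwa [Matrix.det_fin_two] at this
  have hv := (M • z).im_pos
  have hy := z.im_pos
  rw [UpperHalfPlane.cosh_dist']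
  generalize (M • z).re = u at *
  generalize (M • z).im = v at *
  generalize z.re = x at *
  generalize z.im = y at *
  generalize M 0 0 = a at *
  generalize M 0 1 = b at *
  generalize M 1 0 = c at *
  generalize M 1 1 = d at *
  have hS : v * ((c * x + d) ^ 2 + (c * y) ^ 2) = y := by
    linear_combination (c * x + d) * h2 - c * y * h1 + y * hdet
  have hQ : ((u - x) ^ 2 + (v - y) ^ 2) * ((c * x + d) ^ 2 + (c * y) ^ 2)
      = (c * (x ^ 2 + y ^ 2) + (d - a) * x - b) ^ 2 + ((a + d) ^ 2 - 4) * y ^ 2 := by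
    have e1 : (u - x) * (c * x + d) - (v - y) * (c * y)
      = a * x + b - x * (c * x + d) + y * (c * y) := by linear_combination h1
    have e2 : (u - x) * (c * y) + (v - y) * (c * x + d)
      = a * y - x * (c * y) - y * (c * x + d) := by linear_combination h2
    calc _ = ((u - x) * (c * x + d) - (v - y) * (c * y)) ^ 2
        + ((u - x) * (c * y) + (v - y) * (c * x + d)) ^ 2 := by ring
      _ = _ := by rw [e1, e2]; linear_combination (-4 * y ^ 2) * hdet
  generalize (c * x + d) ^ 2 + (c * y) ^ 2 = S at *
  generalize c * (x ^ 2 + y ^ 2) + (d - a) * x - b = N at *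
  subst hS
  have hS0 : S ≠ 0 := by rintro rfl; simp at hy
  field_simp
  linear_combination hQ

lemma entries (A : SL(2, ℝ)) (hA : Matrix.trace (A : Matrix (Fin 2) (Fin 2) ℝ) = 0)
    (z : ℍ) (hz : A • z = z) :
    A 1 1 = - A 0 0 ∧ A 0 0 = A 1 0 * z.re ∧ A 0 1 = - A 1 0 * (z.re ^ 2 + z.im ^ 2) ∧
      (A 1 0 * z.im) ^ 2 = 1 := by
  obtain ⟨h1, h2⟩ := smul_coords A z
  have hdet : A 0 0 * A 1 1 - A 0 1 * A 1 0 = 1 := by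
    have := A.det_coe
    rwa [Matrix.det_fin_two] at this
  rw [Matrix.trace_fin_two] at hA
  have hA' : A 0 0 + A 1 1 = 0 := hA
  have hy := z.im_pos
  rw [hz] at h1 h2
  have hd : A 1 1 = - A 0 0 := by linarith
  have ha : A 0 0 = A 1 0 * z.re := by
    apply mul_left_cancel₀ hy.ne'
    rw [hd] at h2
    linarith
  have hb : A 0 1 = - A 1 0 * (z.re ^ 2 + z.im ^ 2) := by
    rw [hd, ha] at h1
    linarith
  refine ⟨hd, ha, hb, ?_⟩
  rw [hd, hb, ha] at hdet
  linarith

theorem translation_length_of_product_of_involutions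
    (A₁ A₂ : SL(2, ℝ))
    (hA₁ : Matrix.trace (A₁ : Matrix (Fin 2) (Fin 2) ℝ) = 0)
    (hA₂ : Matrix.trace (A₂ : Matrix (Fin 2) (Fin 2) ℝ) = 0)
    (z₁ z₂ : ℍ) (hz₁ : A₁ • z₁ = z₁) (hz₂ : A₂ • z₂ = z₂) (hne : z₁ ≠ z₂) :
    (⨅ z : ℍ, dist ((A₁ * A₂) • z) z) = 2 * dist z₁ z₂ := by
  obtain ⟨d1, a1, b1, c1⟩ := entries A₁ hA₁ z₁ hz₁
  obtain ⟨d2, a2, b2, c2⟩ := entries A₂ hA₂ z₂ hz₂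
  have m (i j : Fin 2) : (A₁ * A₂) i j = A₁ i 0 * A₂ 0 j + A₁ i 1 * A₂ 1 j := by
    rw [Matrix.SpecialLinearGroup.coe_mul, Matrix.mul_apply, Fin.sum_univ_two]
  have ht : Real.cosh (2 * dist z₁ z₂) = ((A₁ * A₂) 0 0 + (A₁ * A₂) 1 1) ^ 2 / 2 - 1 := by
    rw [Real.cosh_two_mul, Real.sinh_sq, UpperHalfPlane.cosh_dist', m, m, d1, d2, b1, b2, a1, a2]
    have h1 := z₁.im_pos
    have h2 := z₂.im_pos
    generalize A₁ 1 0 = p at *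
    generalize A₂ 1 0 = q at *
    have hp : p ^ 2 = 1 / z₁.im ^ 2 := by field_simp; linarith
    have hq : q ^ 2 = 1 / z₂.im ^ 2 := by field_simp; linarith
    have : (p * z₁.re * (q * z₂.re) + -p * (z₁.re ^ 2 + z₁.im ^ 2) * q +
      (p * (-q * (z₂.re ^ 2 + z₂.im ^ 2)) + -(p * z₁.re) * -(q * z₂.re))) ^ 2
      = p ^ 2 * q ^ 2 * ((z₁.re - z₂.re) ^ 2 + z₁.im ^ 2 + z₂.im ^ 2) ^ 2 := by ring
    rw [this, hp, hq]
    field_simp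
    ring
  have hnn : 0 ≤ 2 * dist z₁ z₂ := by positivity
  apply le_antisymm
  · refine (ciInf_le ⟨0, ?_⟩ z₁).trans ?_
    · rintro _ ⟨z, rfl⟩
      exact dist_nonneg
    · rw [← abs_of_nonneg hnn, ← abs_of_nonneg (dist_nonneg (x := (A₁ * A₂) • z₁) (y := z₁)),
        ← Real.cosh_le_cosh, ht, cosh_dist_smul]
      have : (A₁ * A₂) 1 0 * (z₁.re ^ 2 + z₁.im ^ 2) +
          ((A₁ * A₂) 1 1 - (A₁ * A₂) 0 0) * z₁.re - (A₁ * A₂) 0 1 = 0 := by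
        simp only [m]
        rw [d1, d2, b1, b2, a1, a2]
        ring
      rw [this]
      simp
  · refine le_ciInf fun z => ?_
    rw [← abs_of_nonneg hnn, ← abs_of_nonneg (dist_nonneg (x := (A₁ * A₂) • z) (y := z)),
        ← Real.cosh_le_cosh, ht, cosh_dist_smul]
    have : 0 ≤ ((A₁ * A₂) 1 0 * (z.re ^ 2 + z.im ^ 2) +
      ((A₁ * A₂) 1 1 - (A₁ * A₂) 0 0) * z.re - (A₁ * A₂) 0 1) ^ 2 / (2 * z.im ^ 2) := by positivity
    linarith
end

section
/- For all integers a, b, c, d with a·d − 17·b·c = 1, if |a + d| > 2 then |a + d| ≥ 5. In other words, the least trace (in absolute value) of a non-parabolic, non-elliptic element of the congruence subgroup Γ₀(17) of SL(2,ℤ) is 5. -/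
theorem trace_residue_aux : ∀ x : ZMod 17, x * (3 - x) ≠ 1 ∧ x * (-3 - x) ≠ 1 ∧
    x * (4 - x) ≠ 1 ∧ x * (-4 - x) ≠ 1 := by decide

theorem least_hyperbolic_trace_Gamma0_17
    (a b c d : ℤ) (h : a * d - 17 * b * c = 1) (ht : 2 < |a + d|) :
    5 ≤ |a + d| := by
  by_contra hlt
  have h17 : (17 : ZMod 17) = 0 := by decide
  have hm : (a : ZMod 17) * (d : ZMod 17) = 1 := by
    have := congrArg (Int.cast : ℤ → ZMod 17) h
    push_cast at this
    rw [h17] at this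
    simpa using this
  obtain ⟨h1, h2, h3, h4⟩ := trace_residue_aux (a : ZMod 17)
  have hd : d = 3 - a ∨ d = -3 - a ∨ d = 4 - a ∨ d = -4 - a := by
    rcases abs_cases (a + d) with h | h <;> omega
  rcases hd with rfl | rfl | rfl | rfl <;> push_cast at hm <;> contradiction
end

section
/- Let G ≤ SL(2,ℝ) be the image of Γ₀(11) ≤ SL(2,ℤ) under the entrywise embedding of SL(2,ℤ) into SL(2,ℝ), and suppose B ∈ SL(2,ℝ) normalizes G. Then either there exist integers a, b, c, d with 11 ∣ c, a·d − b·c = 1, and B = ±(a b; c d), or there exist integers x, y, z, w with 11·x·w − y·z = 1 and B = ±(x√11, y/√11; z√11, w√11). In particular, every element of the normalizer N(Γ₀(11)) has trace equal to an integer or to an integer multiple of √11. -/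
open Matrix MatrixGroups

/-- Real numbers with pairwise integral products representing a unit are integers. -/
lemma all_int_of_products (f : Fin 4 → ℝ) (hf : ∀ i j, ∃ n : ℤ, f i * f j = n) (u v : ℤ)
    (h : u * (f 0 * f 3) - v * (f 1 * f 2) = 1) : ∀ i, ∃ n : ℤ, f i = n := by
  choose M hM using hf
  obtain ⟨i, hi⟩ : ∃ i, f i ≠ 0 := by
    by_contra hcon
    push Not at hcon
    simp [hcon] at h
  obtain ⟨g, hg⟩ := (IsPrincipalIdealRing.principal (Ideal.span (Set.range (M i)))).principal
  have hg1 : g ∈ Ideal.span (Set.range (M i)) := by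
    rw [hg]; exact Submodule.mem_span_singleton_self g
  rw [Ideal.mem_span_range_iff_exists_fun] at hg1
  obtain ⟨e, he⟩ := hg1
  have hc : ∀ j, ∃ c : ℤ, M i j = c * g := by
    intro j
    have : M i j ∈ Ideal.span (Set.range (M i)) := Ideal.subset_span ⟨j, rfl⟩
    rw [hg, Submodule.mem_span_singleton] at this
    obtain ⟨c, hc⟩ := this
    exact ⟨c, by simpa using hc.symm⟩
  choose c hc using hc
  set t : ℝ := ∑ j, e j * f j with ht
  have hgt : (g : ℝ) = f i * t := by
    rw [← he, ht, Finset.mul_sum]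
    push_cast
    refine Finset.sum_congr rfl fun j _ => ?_
    rw [← hM]; ring
  have hfj : ∀ j, f j = c j * t := by
    intro j
    apply mul_left_cancel₀ hi
    rw [hM, hc]; push_cast; rw [hgt]; ring
  obtain ⟨N, hN⟩ : ∃ N : ℤ, t * t = N := by
    refine ⟨∑ j, ∑ k, e j * e k * M j k, ?_⟩
    rw [ht, Finset.sum_mul_sum]
    push_cast
    refine Finset.sum_congr rfl fun j _ => Finset.sum_congr rfl fun k _ => ?_
    rw [← hM]; ring
  have h1 : N * (u * (c 0 * c 3) - v * (c 1 * c 2)) = 1 := by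
    have : (N : ℝ) * (u * (c 0 * c 3) - v * (c 1 * c 2)) = 1 := by
      rw [← hN, ← h, hfj 0, hfj 1, hfj 2, hfj 3]; ring
    exact_mod_cast this
  have hN1 : N = 1 := by
    rcases Int.eq_one_or_neg_one_of_mul_eq_one h1 with h' | h'
    · exact h'
    · exfalso
      rw [h'] at hN
      push_cast at hN
      nlinarith [mul_self_nonneg t]
  rw [hN1] at hN
  push_cast at hN
  intro j
  rcases mul_self_eq_one_iff.mp hN with h' | h'
  · exact ⟨c j, by rw [hfj, h']; ring⟩
  · exact ⟨-c j, by rw [hfj, h']; push_cast; ring⟩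

lemma conj_entries (B : SL(2, ℝ))
    (hB : B ∈ Subgroup.normalizer
      (Subgroup.map (Matrix.SpecialLinearGroup.map (Int.castRingHom ℝ))
        (CongruenceSubgroup.Gamma0 11) : Set SL(2, ℝ))) (a b c d : ℤ) (h : a * d - b * (11 * c) = 1) :
    ∃ a' b' c' : ℤ,
      a * (B 0 0 * B 1 1) + b * (-(B 0 0 * B 1 0)) + 11 * c * (B 0 1 * B 1 1)
        - d * (B 0 1 * B 1 0) = a' ∧
      (d - a) * (B 0 0 * B 0 1) + b * (B 0 0 * B 0 0) - 11 * c * (B 0 1 * B 0 1) = b' ∧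
      (a - d) * (B 1 0 * B 1 1) - b * (B 1 0 * B 1 0) + 11 * c * (B 1 1 * B 1 1) = 11 * c' := by
  let g : SL(2, ℤ) := ⟨!![a, b; 11 * c, d], by rw [Matrix.det_fin_two_of]; exact h⟩
  have hg : g ∈ CongruenceSubgroup.Gamma0 11 := by
    rw [CongruenceSubgroup.Gamma0_mem]
    simp only [g, Matrix.of_apply, Matrix.cons_val', Matrix.cons_val_zero, Matrix.cons_val_one]
    rw [ZMod.intCast_zmod_eq_zero_iff_dvd _ 11]
    exact ⟨c, by simp⟩
  have h2 := (Subgroup.mem_normalizer_iff.mp hB _).mp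
    (Subgroup.mem_map_of_mem (Matrix.SpecialLinearGroup.map (Int.castRingHom ℝ)) hg)
  obtain ⟨k, hk, hkeq⟩ := h2
  have hk' : k ∈ CongruenceSubgroup.Gamma0 11 := hk
  rw [CongruenceSubgroup.Gamma0_mem, ZMod.intCast_zmod_eq_zero_iff_dvd _ 11] at hk'
  obtain ⟨c', hc'⟩ := hk'
  have hgm : (Matrix.SpecialLinearGroup.map (Int.castRingHom ℝ) g : Matrix (Fin 2) (Fin 2) ℝ) =
      !![(a : ℝ), b; 11 * c, d] := by
    change (!![a, b; 11 * c, d] : Matrix (Fin 2) (Fin 2) ℤ).map (Int.castRingHom ℝ) = _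
    ext i j
    fin_cases i <;> fin_cases j <;> simp
  have hm : ∀ i j, ((k i j : ℤ) : ℝ) = ((B : Matrix (Fin 2) (Fin 2) ℝ) * !![(a : ℝ), b; 11 * c, d] *
      !![B 1 1, - B 0 1; - B 1 0, B 0 0]) i j := by
    intro i j
    have := congrArg (fun X : SL(2, ℝ) => X i j) hkeq
    simp only [Matrix.SpecialLinearGroup.coe_mul, Matrix.SpecialLinearGroup.coe_inv,
      Matrix.adjugate_fin_two] at this
    rw [hgm] at this
    exact this
  have e00 := hm 0 0
  have e01 := hm 0 1
  have e10 := hm 1 0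
  simp [Matrix.mul_apply, Fin.sum_univ_two] at e00 e01 e10
  refine ⟨k 0 0, k 0 1, c', ?_, ?_, ?_⟩
  · rw [e00]; ring
  · rw [e01]; ring
  · have : (11 : ℝ) * c' = (k 1 0 : ℤ) := by rw [hc']; push_cast; ring
    rw [this, e10]; ring

lemma products (B : SL(2, ℝ))
    (hB : B ∈ Subgroup.normalizer
      (Subgroup.map (Matrix.SpecialLinearGroup.map (Int.castRingHom ℝ))
        (CongruenceSubgroup.Gamma0 11) : Set SL(2, ℝ))) :
    ∃ A C D E s n q : ℤ, B 0 0 * B 0 0 = A ∧ B 1 0 * B 1 0 = 11 * C ∧ B 1 1 * B 1 1 = D ∧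
      11 * (B 0 1 * B 0 1) = E ∧ B 0 0 * B 1 1 = s ∧ B 0 0 * B 0 1 = n ∧
      B 1 0 * B 1 1 = 11 * q := by
  have hdet := B.2
  rw [Matrix.det_fin_two] at hdet
  obtain ⟨a1, b1, c1, p1, q1, r1⟩ := conj_entries B hB 1 1 0 1 (by norm_num)
  obtain ⟨a2, b2, c2, p2, q2, r2⟩ := conj_entries B hB 1 0 1 1 (by norm_num)
  obtain ⟨a3, b3, c3, p3, q3, r3⟩ := conj_entries B hB 2 1 1 6 (by norm_num)
  obtain ⟨a4, b4, c4, p4, q4, r4⟩ := conj_entries B hB 2 1 (-1) (-5) (by norm_num)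
  push_cast at *
  -- from 4 and 7: 1 = 2 * 4 - 7
  refine ⟨b1, -c1, c2, -b2, -2 * (a3 - (a1 - 1) - (a2 - 1) - 6) - (a4 - (a1 - 1) + (a2 - 1) + 5),
    2 * (b3 - b1 - b2) + (b4 - b1 + b2), -2 * (c3 - c1 - c2) - (c4 - c1 + c2),
    ?_, ?_, ?_, ?_, ?_, ?_, ?_⟩ <;> push_cast <;> linarith

theorem normalizer_Gamma0_11_elements
    (B : SL(2, ℝ))
    (hB : B ∈ Subgroup.normalizer
      (Subgroup.map (Matrix.SpecialLinearGroup.map (Int.castRingHom ℝ))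
        (CongruenceSubgroup.Gamma0 11))) :
    (∃ a b c d : ℤ, (11 : ℤ) ∣ c ∧ a * d - b * c = 1 ∧
      ((B : Matrix (Fin 2) (Fin 2) ℝ) = !![(a : ℝ), (b : ℝ); (c : ℝ), (d : ℝ)] ∨
       (B : Matrix (Fin 2) (Fin 2) ℝ) = -!![(a : ℝ), (b : ℝ); (c : ℝ), (d : ℝ)])) ∨
    (∃ x y z w : ℤ, 11 * x * w - y * z = 1 ∧
      ((B : Matrix (Fin 2) (Fin 2) ℝ) =
          !![(x : ℝ) * Real.sqrt 11, (y : ℝ) / Real.sqrt 11;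
             (z : ℝ) * Real.sqrt 11, (w : ℝ) * Real.sqrt 11] ∨
       (B : Matrix (Fin 2) (Fin 2) ℝ) =
          -!![(x : ℝ) * Real.sqrt 11, (y : ℝ) / Real.sqrt 11;
              (z : ℝ) * Real.sqrt 11, (w : ℝ) * Real.sqrt 11])) := by
  have hdet := B.2
  rw [Matrix.det_fin_two] at hdet
  obtain ⟨A, C, D, E, s, n, q, hA, hC, hD, hE, hs, hn, hq⟩ := products B hB
  obtain ⟨-, -, -, -, -, p, m, -, -, -, -, -, hp, hm⟩ := products B⁻¹ (inv_mem hB)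
  simp only [Matrix.SpecialLinearGroup.coe_inv, Matrix.adjugate_fin_two, Matrix.of_apply,
    Matrix.cons_val', Matrix.cons_val_zero, Matrix.cons_val_one] at hp hm
  have hBeta : (B : Matrix (Fin 2) (Fin 2) ℝ) = !![B 0 0, B 0 1; B 1 0, B 1 1] :=
    Matrix.eta_fin_two _
  rw [hBeta]
  clear hBeta
  change B 0 0 * B 1 1 - B 0 1 * B 1 0 = 1 at hdet
  generalize B 0 0 = x at *
  generalize B 0 1 = y at *
  generalize B 1 0 = z at *
  generalize B 1 1 = w at *
  have hyz : y * z = ((s - 1 : ℤ) : ℝ) := by push_cast; linarith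
  have i1 : s * (s - 1) = 11 * (m * p) := by
    have : (s : ℝ) * ((s - 1 : ℤ) : ℝ) = 11 * (m * p) := by
      rw [← hyz, ← hs]; linear_combination (-(x * z)) * hp + p * hm
    exact_mod_cast this
  have i2 : s * s = A * D := by
    have : (s : ℝ) * s = A * D := by rw [← hA, ← hD, ← hs]; ring
    exact_mod_cast this
  have i3 : (s - 1) * (s - 1) = E * C := by
    have : ((s - 1 : ℤ) : ℝ) * ((s - 1 : ℤ) : ℝ) = E * C := by
      rw [← hyz, ← hE]; linear_combination y * y * hC
    exact_mod_cast this
  have i4 : E * A = 11 * (n * n) := by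
    have : (E : ℝ) * A = 11 * (n * n) := by rw [← hE, ← hA, ← hn]; ring
    exact_mod_cast this
  have i5 : E * D = 11 * (p * p) := by
    have : (E : ℝ) * D = 11 * (p * p) := by
      rw [← hE, ← hD]; linear_combination 11 * (p - w * y) * hp
    exact_mod_cast this
  have i6 : A * C = 11 * (m * m) := by
    have : (11 * ((A : ℝ) * C)) = 11 * (11 * (m * m)) := by
      rw [← hA]; linear_combination (-(x * x)) * hC + (11 * m - x * z) * hm
    have := mul_left_cancel₀ (by norm_num) this
    exact_mod_cast this
  have p11 : Prime (11 : ℤ) := by norm_num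
  have hmem : (11 : ℤ) ∣ s * (s - 1) := ⟨_, i1⟩
  by_cases h11 : (11 : ℤ) ∣ s
  · right
    have hE' : ¬ (11 : ℤ) ∣ E := fun h => by
      have : (11 : ℤ) ∣ (s - 1) * (s - 1) := i3 ▸ h.mul_right C
      rcases p11.dvd_or_dvd this with h | h <;> omega
    obtain ⟨A', rfl⟩ := (p11.dvd_or_dvd ⟨_, i4⟩ : _ ∨ (11 : ℤ) ∣ A).resolve_left hE'
    obtain ⟨D', rfl⟩ := (p11.dvd_or_dvd ⟨_, i5⟩ : _ ∨ (11 : ℤ) ∣ D).resolve_left hE'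
    obtain ⟨s', rfl⟩ := h11
    push_cast at *
    set r := Real.sqrt 11 with hr
    have hr0 : r ≠ 0 := by positivity
    have hrr : r * r = 11 := Real.mul_self_sqrt (by norm_num)
    obtain ⟨X, hX⟩ : ∃ X, x = X * r := ⟨x / r, by field_simp⟩
    obtain ⟨Y, hY⟩ : ∃ Y, y = Y / r := ⟨y * r, by field_simp⟩
    obtain ⟨Z, hZ⟩ : ∃ Z, z = Z * r := ⟨z / r, by field_simp⟩
    obtain ⟨W, hW⟩ : ∃ W, w = W * r := ⟨w / r, by field_simp⟩
    have kXX : X * X = A' := by subst hX; linear_combination (hA - X * X * hrr) / 11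
    have kZZ : Z * Z = C := by subst hZ; linear_combination (hC - Z * Z * hrr) / 11
    have kWW : W * W = D' := by subst hW; linear_combination (hD - W * W * hrr) / 11
    have kXW : X * W = s' := by subst hX hW; linear_combination (hs - X * W * hrr) / 11
    have kXZ : X * Z = -m := by subst hX hZ; linear_combination (-hm - X * Z * hrr) / 11
    have kZW : Z * W = q := by subst hZ hW; linear_combination (hq - Z * W * hrr) / 11
    have hy' : Y = y * r := by rw [hY]; field_simp
    have kYY : Y * Y = E := by rw [hy']; linear_combination hE + y * y * hrr
    have kXY : X * Y = n := by rw [hy', ← hn, hX]; ring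
    have kYZ : Y * Z = 11 * s' - 1 := by rw [hy', ← hyz, hZ]; ring
    have kYW : Y * W = -p := by rw [hy']; rw [hW] at hp; linear_combination -hp
    have key := all_int_of_products ![X, Y, Z, W] (by
      intro i j
      fin_cases i <;> fin_cases j <;> simp
      · exact ⟨_, kXX⟩
      · exact ⟨_, kXY⟩
      · exact ⟨-m, by rw [kXZ]; push_cast; ring⟩
      · exact ⟨_, kXW⟩
      · exact ⟨n, by rw [← kXY]; ring⟩
      · exact ⟨_, kYY⟩
      · exact ⟨11 * s' - 1, by rw [kYZ]; push_cast; ring⟩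
      · exact ⟨-p, by rw [kYW]; push_cast; ring⟩
      · exact ⟨-m, by rw [mul_comm, kXZ]; push_cast; ring⟩
      · exact ⟨11 * s' - 1, by rw [mul_comm, kYZ]; push_cast; ring⟩
      · exact ⟨_, kZZ⟩
      · exact ⟨_, kZW⟩
      · exact ⟨s', by rw [mul_comm, kXW]⟩
      · exact ⟨-p, by rw [mul_comm, kYW]; push_cast; ring⟩
      · exact ⟨q, by rw [mul_comm, kZW]⟩
      · exact ⟨_, kWW⟩) 11 1 (by
        simp
        rw [kXW, kYZ]; ring)
    obtain ⟨a, ha⟩ := key 0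
    obtain ⟨b, hb⟩ := key 1
    obtain ⟨c, hc⟩ := key 2
    obtain ⟨d, hd⟩ := key 3
    simp at ha hb hc hd
    refine ⟨a, b, c, d, ?_, Or.inl ?_⟩
    · have : (11 : ℝ) * a * d - b * c = 1 := by
        rw [← ha, ← hb, ← hc, ← hd]; linear_combination 11 * kXW - kYZ
      exact_mod_cast this
    · rw [hX, hY, hZ, hW, ha, hb, hc, hd]
  · left
    have hA' : ¬ (11 : ℤ) ∣ A := fun h => by
      have : (11 : ℤ) ∣ s * s := i2 ▸ h.mul_right D
      rcases p11.dvd_or_dvd this with h | h <;> omega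
    obtain ⟨E', rfl⟩ := (p11.dvd_or_dvd ⟨_, i4⟩ : (11 : ℤ) ∣ E ∨ _).resolve_right hA'
    obtain ⟨C', rfl⟩ := (p11.dvd_or_dvd ⟨_, i6⟩ : _ ∨ (11 : ℤ) ∣ C).resolve_left hA'
    obtain ⟨s', hs'⟩ := (p11.dvd_or_dvd hmem).resolve_left h11
    obtain rfl : s = 11 * s' + 1 := by omega
    push_cast at *
    obtain ⟨Z, rfl⟩ : ∃ Z, z = 11 * Z := ⟨z / 11, by ring⟩
    have kYY : y * y = E' := by linarith
    have kZZ : Z * Z = C' := by linarith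
    have kXZ : x * Z = -m := by linarith
    have kYZ : y * Z = s' := by linarith
    have kZW : Z * w = q := by linarith
    have kYW : y * w = -p := by linarith
    have key := all_int_of_products ![x, y, Z, w] (by
      intro i j
      fin_cases i <;> fin_cases j <;> simp
      · exact ⟨_, hA⟩
      · exact ⟨_, hn⟩
      · exact ⟨-m, by rw [kXZ]; push_cast; ring⟩
      · exact ⟨11 * s' + 1, by rw [hs]; push_cast; ring⟩
      · exact ⟨n, by rw [← hn]; ring⟩
      · exact ⟨_, kYY⟩
      · exact ⟨_, kYZ⟩
      · exact ⟨-p, by rw [kYW]; push_cast; ring⟩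
      · exact ⟨-m, by rw [mul_comm, kXZ]; push_cast; ring⟩
      · exact ⟨s', by rw [mul_comm, kYZ]⟩
      · exact ⟨_, kZZ⟩
      · exact ⟨_, kZW⟩
      · exact ⟨11 * s' + 1, by rw [mul_comm, hs]; push_cast; ring⟩
      · exact ⟨-p, by rw [mul_comm, kYW]; push_cast; ring⟩
      · exact ⟨q, by rw [mul_comm, kZW]⟩
      · exact ⟨_, hD⟩) 1 11 (by
        simp
        linarith)
    obtain ⟨a, ha⟩ := key 0
    obtain ⟨b, hb⟩ := key 1
    obtain ⟨c, hc⟩ := key 2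
    obtain ⟨d, hd⟩ := key 3
    simp at ha hb hc hd
    refine ⟨a, b, 11 * c, d, ⟨c, rfl⟩, ?_, Or.inl ?_⟩
    · have : (a : ℝ) * d - b * (11 * c) = 1 := by
        rw [← ha, ← hb, ← hc, ← hd]; linarith
      exact_mod_cast this
    · rw [ha, hb, hc, hd]; push_cast; rfl
end

section
/- Let G ≤ SL(2,ℝ) be the image of Γ₀(17) ≤ SL(2,ℤ) under the entrywise embedding of SL(2,ℤ) into SL(2,ℝ), and suppose B ∈ SL(2,ℝ) normalizes G. Then there exists an integer m such that tr B = m or tr B = m·√17; that is, the traces of elements of N(Γ₀(17)) are either integers or integer multiples of √17. -/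
open Matrix MatrixGroups

/-- The entries of the conjugate by `B` of an element of `Γ₀(17)` are integers. -/
lemma conj_entries_s7 (B : SL(2, ℝ))
    (hB : B ∈ Subgroup.normalizer
      (Subgroup.map (Matrix.SpecialLinearGroup.map (Int.castRingHom ℝ))
        (CongruenceSubgroup.Gamma0 17)))
    (x y z w : ℤ) (h : x * w - y * (17 * z) = 1) :
    ∃ p q r s : ℤ,
      (p : ℝ) = (B 0 0 * x + B 0 1 * (17 * z)) * B 1 1 - (B 0 0 * y + B 0 1 * w) * B 1 0 ∧
      (q : ℝ) = -(B 0 0 * x + B 0 1 * (17 * z)) * B 0 1 + (B 0 0 * y + B 0 1 * w) * B 0 0 ∧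
      (17 * r : ℝ) = (B 1 0 * x + B 1 1 * (17 * z)) * B 1 1 - (B 1 0 * y + B 1 1 * w) * B 1 0 ∧
      (s : ℝ) = -(B 1 0 * x + B 1 1 * (17 * z)) * B 0 1 + (B 1 0 * y + B 1 1 * w) * B 0 0 := by
  let g : SL(2, ℤ) := ⟨!![x, y; 17 * z, w], by rw [Matrix.det_fin_two_of]; exact h⟩
  have hg : g ∈ CongruenceSubgroup.Gamma0 17 := by
    rw [CongruenceSubgroup.Gamma0_mem]
    have : g 1 0 = 17 * z := rfl
    rw [this]
    push_cast
    have : (17 : ZMod 17) = 0 := by decide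
    rw [this, zero_mul]
  have h1 := (Subgroup.mem_normalizer_iff.mp hB _).mp (Subgroup.mem_map_of_mem _ hg)
  obtain ⟨k, hk0, hk⟩ := h1
  have hk1 : ((k 1 0 : ℤ) : ZMod 17) = 0 := hk0
  rw [ZMod.intCast_zmod_eq_zero_iff_dvd] at hk1
  obtain ⟨r, hr⟩ := hk1
  have hr' : (17 * r : ℝ) = ((k 1 0 : ℤ) : ℝ) := by
    rw [hr]
    push_cast
    rfl
  have e : ∀ i j, ((k i j : ℤ) : ℝ) =
      ((B : Matrix (Fin 2) (Fin 2) ℝ) * !![(x:ℝ), y; 17 * z, w] *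
        !![B 1 1, -B 0 1; -B 1 0, B 0 0]) i j := by
    intro i j
    have h2 : ((SpecialLinearGroup.map (Int.castRingHom ℝ) k : SL(2, ℝ)) :
        Matrix (Fin 2) (Fin 2) ℝ) i j = ((k i j : ℤ) : ℝ) := rfl
    have h3 : ((SpecialLinearGroup.map (Int.castRingHom ℝ) g : SL(2, ℝ)) :
        Matrix (Fin 2) (Fin 2) ℝ) = !![(x:ℝ), y; 17 * z, w] := by
      ext i j
      fin_cases i <;> fin_cases j
      · rfl
      · rfl
      · change (((17 * z : ℤ)) : ℝ) = 17 * z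
        push_cast
        rfl
      · rfl
    have h4 : ((SpecialLinearGroup.map (Int.castRingHom ℝ) k : SL(2, ℝ)) :
        Matrix (Fin 2) (Fin 2) ℝ) = (B : Matrix (Fin 2) (Fin 2) ℝ) *
        ((SpecialLinearGroup.map (Int.castRingHom ℝ) g : SL(2, ℝ)) :
        Matrix (Fin 2) (Fin 2) ℝ) * Matrix.adjugate (B : Matrix (Fin 2) (Fin 2) ℝ) :=
      congrArg Subtype.val hk
    rw [Matrix.adjugate_fin_two] at h4
    rw [h3] at h4
    rw [← h2, h4]
  refine ⟨k 0 0, k 0 1, r, k 1 1, ?_, ?_, ?_, ?_⟩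
  on_goal 3 => rw [hr']
  all_goals
    rw [e]
    simp [Matrix.mul_apply, Fin.sum_univ_two]
    ring

lemma descend (m s : ℤ) (hm : m ≠ 0) (hs : Squarefree s) (t x : ℝ)
    (ht : t ^ 2 = m ^ 2 * s) (A y : ℤ) (hA : x ^ 2 = A) (hy : x * t = y) :
    ∃ k : ℤ, x * t = m * s * k := by
  have h : y ^ 2 = A * (m ^ 2 * s) := by
    have : (y : ℝ) ^ 2 = A * (m ^ 2 * s) := by rw [← hy, mul_pow, hA, ht]
    exact_mod_cast this
  have h1 : m ∣ y := by
    rw [← Int.pow_dvd_pow_iff (two_ne_zero)]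
    exact ⟨A * s, by rw [h]; ring⟩
  obtain ⟨u, rfl⟩ := h1
  have h2 : u ^ 2 = A * s := by
    have : m ^ 2 ≠ 0 := pow_ne_zero _ hm
    apply mul_left_cancel₀ this
    linarith
  have h3 : s ∣ u := (hs.dvd_pow_iff_dvd two_ne_zero).mp ⟨A, by rw [h2]; ring⟩
  obtain ⟨k, rfl⟩ := h3
  exact ⟨k, by rw [hy]; push_cast; ring⟩

theorem normalizer_Gamma0_17_traces
    (B : SL(2, ℝ))
    (hB : B ∈ Subgroup.normalizer
      (Subgroup.map (Matrix.SpecialLinearGroup.map (Int.castRingHom ℝ))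
        (CongruenceSubgroup.Gamma0 17))) :
    ∃ m : ℤ, Matrix.trace (B : Matrix (Fin 2) (Fin 2) ℝ) = (m : ℝ) ∨
      Matrix.trace (B : Matrix (Fin 2) (Fin 2) ℝ) = (m : ℝ) * Real.sqrt 17 := by
  obtain ⟨p1, q1, r1, s1, hp1, hq1, hr1, hs1⟩ := conj_entries_s7 B hB 1 1 0 1 (by norm_num)
  obtain ⟨p2, q2, r2, s2, hp2, hq2, hr2, hs2⟩ := conj_entries_s7 B hB 1 0 1 1 (by norm_num)
  obtain ⟨p3, q3, r3, s3, hp3, hq3, hr3, hs3⟩ := conj_entries_s7 B hB 4 (-1) 1 (-4) (by norm_num)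
  obtain ⟨p4, q4, r4, s4, hp4, hq4, hr4, hs4⟩ := conj_entries_s7 B hB 2 1 1 9 (by norm_num)
  have hdet : B 0 0 * B 1 1 - B 0 1 * B 1 0 = 1 := by
    have := B.det_coe
    rwa [Matrix.det_fin_two] at this
  have htr : Matrix.trace (B : Matrix (Fin 2) (Fin 2) ℝ) = B 0 0 + B 1 1 :=
    Matrix.trace_fin_two _
  rw [htr]
  generalize B 0 0 = a at *
  generalize B 0 1 = b at *
  generalize B 1 0 = c at *
  generalize B 1 1 = d at *
  push_cast at *
  have haa : ∃ n : ℤ, a ^ 2 = n := ⟨q1, by linarith⟩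
  have hcc : ∃ n : ℤ, c ^ 2 = n := ⟨-(17 * r1), by push_cast; linarith⟩
  have hac : ∃ n : ℤ, a * c = n := ⟨1 - p1, by push_cast; linarith⟩
  have hbb : ∃ n : ℤ, 17 * b ^ 2 = n := ⟨-q2, by push_cast; linarith⟩
  have hbd : ∃ n : ℤ, 17 * (b * d) = n := ⟨p2 - 1, by push_cast; linarith⟩
  have hdd : ∃ n : ℤ, d ^ 2 = n := ⟨r2, by linarith⟩
  have had : ∃ n : ℤ, a * d = n := ⟨p3 + p4 - 5 - 2 * (p2 - 1), by
    push_cast; linear_combination (-1) * hp3 - hp4 + 2 * hp2 - 3 * hdet⟩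
  have hab : ∃ n : ℤ, a * b = n := ⟨2 * q2 - q3 - q4, by
    push_cast; linear_combination hq3 + hq4 - 2 * hq2⟩
  have hcd : ∃ n : ℤ, c * d = n := ⟨17 * (r3 + r4 - 2 * r2), by
    push_cast; linear_combination -hr3 - hr4 + 2 * hr2⟩
  clear hp1 hp2 hp3 hp4 hq1 hq2 hq3 hq4 hr1 hr2 hr3 hr4 hs1 hs2 hs3 hs4 htr
  obtain ⟨naa, haa⟩ := haa
  obtain ⟨nbb, hbb⟩ := hbb
  obtain ⟨ncc, hcc⟩ := hcc
  obtain ⟨ndd, hdd⟩ := hdd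
  obtain ⟨nac, hac⟩ := hac
  obtain ⟨nbd, hbd⟩ := hbd
  obtain ⟨nad, had⟩ := had
  obtain ⟨nab, hab⟩ := hab
  obtain ⟨ncd, hcd⟩ := hcd
  have hN : (a + d) ^ 2 = ((naa + ndd + 2 * nad : ℤ) : ℝ) := by
    push_cast
    linear_combination haa + hdd + 2 * had
  have hN0 : 0 ≤ naa + ndd + 2 * nad := by
    have : (0 : ℝ) ≤ ((naa + ndd + 2 * nad : ℤ) : ℝ) := by rw [← hN]; positivity
    exact_mod_cast this
  obtain ⟨s, m, hsm, hs⟩ := Nat.sq_mul_squarefree (naa + ndd + 2 * nad).toNat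
  have hsm' : ((m : ℤ) ^ 2 * (s : ℤ)) = naa + ndd + 2 * nad := by
    rw [← Int.toNat_of_nonneg hN0, ← hsm]
    push_cast
    rfl
  rw [← hsm'] at hN
  by_cases hm : m = 0
  · refine ⟨0, Or.inl ?_⟩
    subst hm
    push_cast at hN ⊢
    have : (a + d) ^ 2 = 0 := by rw [hN]; ring
    exact pow_eq_zero_iff two_ne_zero |>.mp this
  have hmz : (m : ℤ) ≠ 0 := by exact_mod_cast hm
  have hsz : Squarefree (s : ℤ) := Int.squarefree_natCast.mpr hs
  push_cast at hN
  have hN' : (a + d) ^ 2 = ((m : ℤ) : ℝ) ^ 2 * ((s : ℤ) : ℝ) := by push_cast; exact hN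
  obtain ⟨ka, ha⟩ := descend m s hmz hsz (a + d) a hN' naa (naa + nad) haa
    (by push_cast; linear_combination haa + had)
  obtain ⟨kd, hd⟩ := descend m s hmz hsz (a + d) d hN' ndd (ndd + nad) hdd
    (by push_cast; linear_combination hdd + had)
  obtain ⟨kc, hc⟩ := descend m s hmz hsz (a + d) c hN' ncc (nac + ncd) hcc
    (by push_cast; linear_combination hac + hcd)
  obtain ⟨kb, hb⟩ := descend m s hmz hsz (a + d) (17 * b) hN' (17 * nbb) (17 * nab + nbd)
    (by push_cast; linear_combination 17 * hbb) (by push_cast; linear_combination 17 * hab + hbd)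
  have hs0 : (s : ℤ) ≠ 0 := by exact_mod_cast hs.ne_zero
  have key : (17 : ℤ) = s * (17 * (ka * kd) - kb * kc) := by
    have h1 : ((m : ℤ) ^ 2 * s) * 17 =
        ((m : ℤ) ^ 2 * s) * (s * (17 * (ka * kd) - kb * kc)) := by
      have : ((m : ℝ) ^ 2 * s) * 17 =
          ((m : ℝ) ^ 2 * s) * (s * (17 * (ka * kd) - kb * kc)) := by
        push_cast at ha hb hc hd
        calc ((m : ℝ) ^ 2 * s) * 17 = 17 * ((a * (a + d)) * (d * (a + d)))
              - (17 * b * (a + d)) * (c * (a + d)) := by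
                rw [← hN]
                linear_combination (-17) * (a + d) ^ 2 * hdet
          _ = _ := by
                rw [ha, hb, hc, hd]
                ring
      exact_mod_cast this
    exact mul_left_cancel₀ (mul_ne_zero (pow_ne_zero 2 hmz) hs0) h1
  have hdvd : s ∣ 17 := by
    have : (s : ℤ) ∣ ((17 : ℕ) : ℤ) := ⟨_, key⟩
    exact_mod_cast this
  rcases (Nat.dvd_prime (by norm_num : Nat.Prime 17)).mp hdvd with rfl | rfl
  · have : (a + d) ^ 2 = (m : ℝ) ^ 2 := by rw [hN]; simp
    rcases sq_eq_sq_iff_eq_or_eq_neg.mp this with h | h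
    · exact ⟨m, Or.inl (by rw [h]; simp)⟩
    · exact ⟨-m, Or.inl (by rw [h]; simp)⟩
  · have : (a + d) ^ 2 = ((m : ℝ) * Real.sqrt 17) ^ 2 := by
      rw [hN, mul_pow, Real.sq_sqrt (by norm_num)]
      simp
    rcases sq_eq_sq_iff_eq_or_eq_neg.mp this with h | h
    · exact ⟨m, Or.inr (by rw [h]; simp)⟩
    · exact ⟨-m, Or.inr (by rw [h]; simp)⟩
end

section
/- Let G ≤ SL(2,ℝ) be the image of Γ₀(17) ≤ SL(2,ℤ) under the entrywise embedding of SL(2,ℤ) into SL(2,ℝ), and suppose B ∈ SL(2,ℝ) normalizes G. If |tr B| > 2 (B is hyperbolic), then |tr B| ≥ √17. In other words, the shortest closed geodesic on the quotient of ℍ by N(Γ₀(17)) comes from an element of trace √17. -/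
open Matrix MatrixGroups

lemma aux_arith (A D β γ p q r u : ℤ) (hpq : p - q = 1) (hAD : A * D = p ^ 2)
    (hbc : β * γ = q ^ 2) (hr : 17 * (A * γ) = r ^ 2) (hu : 17 * (γ * D) = u ^ 2)
    (hA : 0 ≤ A) (ht : 4 < A + D + 2 * p) : 17 ≤ A + D + 2 * p := by
  have h17 : Prime (17 : ℤ) := by rw [Int.prime_iff_natAbs_prime]; norm_num
  by_cases h : (17 : ℤ) ∣ A
  · have hp : (17 : ℤ) ∣ p := h17.dvd_of_dvd_pow (n := 2) (hAD ▸ h.mul_right D)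
    have hγ : ¬ (17 : ℤ) ∣ γ := by
      intro hg
      have hq : (17 : ℤ) ∣ q := h17.dvd_of_dvd_pow (n := 2) (hbc ▸ hg.mul_left β)
      omega
    obtain ⟨v, rfl⟩ : (17 : ℤ) ∣ u := h17.dvd_of_dvd_pow (n := 2) (hu ▸ dvd_mul_right _ _)
    have : (17 : ℤ) ∣ γ * D := ⟨v ^ 2, by linarith⟩
    have hD := (h17.dvd_or_dvd this).resolve_left hγ
    omega
  · obtain ⟨s, rfl⟩ : (17 : ℤ) ∣ r := h17.dvd_of_dvd_pow (n := 2) (hr ▸ dvd_mul_right _ _)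
    have : (17 : ℤ) ∣ A * γ := ⟨s ^ 2, by linarith⟩
    obtain ⟨g, rfl⟩ := (h17.dvd_or_dvd this).resolve_left h
    have hq : (17 : ℤ) ∣ q := h17.dvd_of_dvd_pow (n := 2) (hbc ▸ (dvd_mul_right _ _).mul_left β)
    have hAg : A * g = s ^ 2 := by linarith
    have hcop : IsCoprime p q := ⟨1, -1, by linarith⟩
    have hcop2 : IsCoprime (p ^ 2) (q ^ 2) := hcop.pow
    have hcop3 : IsCoprime A g :=
      (hcop2.of_isCoprime_of_dvd_left ⟨D, hAD.symm⟩).of_isCoprime_of_dvd_right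
        ⟨17 * β, by linarith⟩
    obtain ⟨k, hk⟩ : ∃ k : ℤ, A = k ^ 2 := by
      obtain ⟨k, hk | hk⟩ := Int.sq_of_isCoprime hcop3 hAg
      · exact ⟨k, hk⟩
      · exact ⟨0, by nlinarith [sq_nonneg k]⟩
    have hk0 : k ≠ 0 := by rintro rfl; apply h; simp [hk]
    obtain ⟨l, rfl⟩ : k ∣ p := by
      rw [← Int.pow_dvd_pow_iff (n := 2) (by norm_num)]
      exact ⟨D, by rw [← hAD, hk]⟩
    have hD : D = l ^ 2 := by
      have : k ^ 2 * D = k ^ 2 * l ^ 2 := by rw [← hk, hAD, hk]; ring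
      exact mul_left_cancel₀ (pow_ne_zero 2 hk0) this
    subst hk hD
    obtain ⟨z, rfl⟩ := hq
    by_contra hlt
    obtain ⟨w, rfl⟩ : ∃ w, l = w - k := ⟨l + k, by ring⟩
    have e : k ^ 2 + (w - k) ^ 2 + 2 * (k * (w - k)) = w ^ 2 := by ring
    rw [e] at ht hlt
    have h1 : w ≤ 4 := by nlinarith
    have h2 : -4 ≤ w := by nlinarith
    have hm : (k : ZMod 17) * (w - k) = 1 := by
      have : k * (w - k) = 1 + 17 * z := by linarith
      have := congrArg (Int.cast : ℤ → ZMod 17) this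
      push_cast at this
      rw [this, show (17 : ZMod 17) = 0 from by decide]; ring
    generalize (k : ZMod 17) = x at hm
    have h3 : w = 3 ∨ w = -3 ∨ w = 4 ∨ w = -4 := by
      interval_cases w <;> simp_all
    rcases h3 with rfl | rfl | rfl | rfl <;> push_cast at hm <;> revert x <;> decide

lemma aux_ext (B : SL(2, ℝ))
    (hB : ∀ h, h ∈ (Subgroup.map (Matrix.SpecialLinearGroup.map (Int.castRingHom ℝ))
        (CongruenceSubgroup.Gamma0 17)) → B * h * B⁻¹ ∈
        (Subgroup.map (Matrix.SpecialLinearGroup.map (Int.castRingHom ℝ))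
        (CongruenceSubgroup.Gamma0 17))) :
    (∃ n : ℤ, (B 0 0) ^ 2 = n) ∧ (∃ n : ℤ, B 0 0 * B 1 0 = n) ∧
    (∃ n : ℤ, (B 1 0) ^ 2 = 17 * n) ∧ (∃ n : ℤ, (B 1 1) ^ 2 = n) ∧
    (∃ n : ℤ, 17 * (B 0 1) ^ 2 = n) := by
  have hdet : B 0 0 * B 1 1 - B 0 1 * B 1 0 = 1 := by
    rw [← Matrix.det_fin_two]; exact B.2
  obtain ⟨T, hT⟩ : ∃ T : SL(2, ℤ), (T : Matrix (Fin 2) (Fin 2) ℤ) = !![1, 1; 0, 1] :=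
    ⟨⟨!![1, 1; 0, 1], by simp [Matrix.det_fin_two]⟩, rfl⟩
  obtain ⟨L, hL⟩ : ∃ T : SL(2, ℤ), (T : Matrix (Fin 2) (Fin 2) ℤ) = !![1, 0; 17, 1] :=
    ⟨⟨!![1, 0; 17, 1], by simp [Matrix.det_fin_two]⟩, rfl⟩
  have hTm : T ∈ CongruenceSubgroup.Gamma0 17 := by
    rw [CongruenceSubgroup.Gamma0_mem, hT]; simp
  have hLm : L ∈ CongruenceSubgroup.Gamma0 17 := by
    rw [CongruenceSubgroup.Gamma0_mem, hL]; decide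
  obtain ⟨X, hX, hXe⟩ := hB _ ⟨T, hTm, rfl⟩
  obtain ⟨Y, hY, hYe⟩ := hB _ ⟨L, hLm, rfl⟩
  rw [SetLike.mem_coe, CongruenceSubgroup.Gamma0_mem, ZMod.intCast_zmod_eq_zero_iff_dvd] at hX hY
  have hX' := fun i j => congrArg (fun M : SL(2, ℝ) => M i j) hXe
  have hY' := fun i j => congrArg (fun M : SL(2, ℝ) => M i j) hYe
  have x00 := hX' 0 0
  have x01 := hX' 0 1
  have x10 := hX' 1 0
  have y01 := hY' 0 1
  have y10 := hY' 1 0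
  simp [hT, hL, Matrix.mul_apply, Fin.sum_univ_two, Matrix.SpecialLinearGroup.coe_inv,
    Matrix.adjugate_fin_two] at x00 x01 x10 y01 y10
  obtain ⟨m, hm⟩ := hX
  obtain ⟨n, hn⟩ := hY
  rw [hm] at x10
  rw [hn] at y10
  push_cast at x10 y10
  refine ⟨⟨X 0 1, by linarith⟩, ⟨1 - X 0 0, ?_⟩, ⟨-m, ?_⟩, ⟨n, ?_⟩, ⟨-Y 0 1, ?_⟩⟩ <;>
    push_cast <;> linarith

theorem shortest_geodesic_normalizer_Gamma0_17
    (B : SL(2, ℝ))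
    (hB : B ∈ Subgroup.normalizer
      (Subgroup.map (Matrix.SpecialLinearGroup.map (Int.castRingHom ℝ))
        (CongruenceSubgroup.Gamma0 17)))
    (hyp : 2 < |Matrix.trace (B : Matrix (Fin 2) (Fin 2) ℝ)|) :
    Real.sqrt 17 ≤ |Matrix.trace (B : Matrix (Fin 2) (Fin 2) ℝ)| := by
  have hdet : B 0 0 * B 1 1 - B 0 1 * B 1 0 = 1 := by
    rw [← Matrix.det_fin_two]; exact B.2
  have hB' := inv_mem hB
  obtain ⟨⟨A, hA⟩, ⟨r, hr⟩, ⟨γ, hγ⟩, ⟨D, hD⟩, ⟨β, hβ⟩⟩ :=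
    aux_ext B (fun h hh => (Subgroup.mem_normalizer_iff.1 hB h).1 hh)
  obtain ⟨-, ⟨u, hu⟩, -⟩ :=
    aux_ext B⁻¹ (fun h hh => (Subgroup.mem_normalizer_iff.1 hB' h).1 hh)
  simp [Matrix.SpecialLinearGroup.coe_inv, Matrix.adjugate_fin_two] at hu
  rw [Matrix.trace_fin_two] at hyp ⊢
  generalize B 0 0 = a at *
  generalize B 0 1 = b at *
  generalize B 1 0 = c at *
  generalize B 1 1 = d at *
  have e1 : (b * c) ^ 2 = β * γ := by
    rw [← hβ, mul_pow, hγ]; ring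
  have e2 : (a * d) ^ 2 = A * D := by rw [← hA, ← hD]; ring
  obtain ⟨n, hn⟩ : ∃ n : ℤ, 2 * (b * c) = n := ⟨A * D - 1 - β * γ, by
    push_cast; rw [← e1, ← e2, show a * d = 1 + b * c by linarith]; ring⟩
  have e3 : n ^ 2 = 4 * (β * γ) := by
    have : (n : ℝ) ^ 2 = 4 * (β * γ) := by rw [← hn, ← e1]; ring
    exact_mod_cast this
  obtain ⟨q, rfl⟩ : (2 : ℤ) ∣ n :=
    Int.prime_two.dvd_of_dvd_pow (n := 2) ⟨2 * (β * γ), by rw [e3]; ring⟩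
  have hq : b * c = q := by push_cast at hn; linarith
  have hp : a * d = 1 + q := by linarith
  have ht2 : (a + d) ^ 2 = ((A + D + 2 * (1 + q) : ℤ) : ℝ) := by
    push_cast; rw [← hA, ← hD, ← hp]; ring
  have key := aux_arith A D β γ (1 + q) q r u (by ring)
    (by have : (A : ℝ) * D = (1 + q) ^ 2 := by rw [← e2, hp]
        exact_mod_cast this)
    (by linarith)
    (by have : 17 * ((A : ℝ) * γ) = r ^ 2 := by rw [← hr, mul_pow, hγ, hA]; ring
        exact_mod_cast this)
    (by have : 17 * ((γ : ℝ) * D) = u ^ 2 := by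
          have : (u : ℝ) ^ 2 = c ^ 2 * d ^ 2 := by rw [← hu]; ring
          rw [this, hγ, hD]; ring
        exact_mod_cast this)
    (by have : (0 : ℝ) ≤ A := hA ▸ sq_nonneg a
        exact_mod_cast this)
    (by have : (4 : ℝ) < (a + d) ^ 2 := by rw [← sq_abs]; nlinarith
        rw [ht2] at this
        exact_mod_cast this)
  apply Real.sqrt_le_iff.2 ⟨abs_nonneg _, _⟩
  rw [sq_abs, ht2]
  exact_mod_cast key
end

section
/- Let G ≤ SL(2,ℝ) be the image of Γ₀(11) ≤ SL(2,ℤ) under the entrywise embedding of SL(2,ℤ) into SL(2,ℝ), and suppose B ∈ SL(2,ℝ) normalizes G. If |tr B| > 2 (B is hyperbolic), then |tr B| ≥ 3. -/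
open Matrix MatrixGroups

lemma conj_entries_s9 (B : SL(2, ℝ))
    (hB : B ∈ Subgroup.normalizer
      (Subgroup.map (Matrix.SpecialLinearGroup.map (Int.castRingHom ℝ))
        (CongruenceSubgroup.Gamma0 11))) :
    (∃ k : ℤ, (k : ℝ) = B 0 0 ^ 2) ∧ (∃ k : ℤ, (k : ℝ) = B 1 0 ^ 2) ∧
    (∃ k : ℤ, (k : ℝ) = B 0 0 * B 1 0) ∧
    (∃ k : ℤ, (k : ℝ) = 11 * B 0 1 ^ 2) ∧ (∃ k : ℤ, (k : ℝ) = 11 * (B 0 1 * B 1 1)) := by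
  rw [Subgroup.mem_normalizer_iff] at hB
  have hdet := B.det_coe
  rw [Matrix.det_fin_two] at hdet
  obtain ⟨T, t00, t01, t10, t11⟩ : ∃ T : SL(2, ℤ), T 0 0 = 1 ∧ T 0 1 = 1 ∧ T 1 0 = 0 ∧ T 1 1 = 1 :=
    ⟨⟨!![1, 1; 0, 1], by simp [Matrix.det_fin_two]⟩, rfl, rfl, rfl, rfl⟩
  obtain ⟨U, u00, u01, u10, u11⟩ : ∃ T : SL(2, ℤ), T 0 0 = 1 ∧ T 0 1 = 0 ∧ T 1 0 = 11 ∧ T 1 1 = 1 :=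
    ⟨⟨!![1, 0; 11, 1], by simp [Matrix.det_fin_two]⟩, rfl, rfl, rfl, rfl⟩
  have hT : T ∈ CongruenceSubgroup.Gamma0 11 := by
    rw [CongruenceSubgroup.Gamma0_mem, t10]
    decide
  have hU : U ∈ CongruenceSubgroup.Gamma0 11 := by
    rw [CongruenceSubgroup.Gamma0_mem, u10]
    decide
  obtain ⟨V, -, hV⟩ := (hB _).1 (Subgroup.mem_map_of_mem _ hT)
  obtain ⟨W, -, hW⟩ := (hB _).1 (Subgroup.mem_map_of_mem _ hU)
  have v (i j) := congrArg (fun M : SL(2, ℝ) => M i j) hV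
  have w (i j) := congrArg (fun M : SL(2, ℝ) => M i j) hW
  have v00 := v 0 0
  have v01 := v 0 1
  have v10 := v 1 0
  have w00 := w 0 0
  have w01 := w 0 1
  simp [t00, t01, t10, t11, u00, u01, u10, u11, Matrix.mul_apply, Fin.sum_univ_two, Matrix.SpecialLinearGroup.coe_inv,
    Matrix.adjugate_fin_two] at v00 v01 v10 w00 w01
  refine ⟨⟨V 0 1, ?_⟩, ⟨-V 1 0, ?_⟩, ⟨1 - V 0 0, ?_⟩, ⟨-W 0 1, ?_⟩, ⟨W 0 0 - 1, ?_⟩⟩ <;>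
    push_cast <;> linarith

lemma no_small (N a b c d P Q R S : ℤ) (h1 : 4 < N) (h2 : N < 9)
    (ha : a ^ 2 = N * P) (hb : b ^ 2 = N * Q) (hc : c ^ 2 = N * R) (hd : d ^ 2 = N * S)
    (h : 11 * N = 11 * (a * d) - b * c) : False := by
  have key : ∃ M : ℤ, ¬ (M ^ 2 ∣ 11 * N) ∧ ∀ x y : ℤ, x ^ 2 = N * y → M ∣ x := by
    have z (n : ℕ) (hn : ∀ x : ZMod n, x ^ 2 = 0 → x = 0) (x y : ℤ)
        (hxy : x ^ 2 = n * y) : (n : ℤ) ∣ x := by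
      rw [← CharP.intCast_eq_zero_iff (ZMod n) n]
      apply hn
      have := congrArg (Int.cast : ℤ → ZMod n) hxy
      simpa using this
    obtain rfl | rfl | rfl | rfl : N = 5 ∨ N = 6 ∨ N = 7 ∨ N = 8 := by omega
    · exact ⟨5, by norm_num, z 5 (by decide)⟩
    · exact ⟨6, by norm_num, z 6 (by decide)⟩
    · exact ⟨7, by norm_num, z 7 (by decide)⟩
    · refine ⟨4, by norm_num, fun x y hxy => ?_⟩
      have h2 : (2 : ℤ) ∣ x := Int.prime_two.dvd_of_dvd_pow (n := 2) ⟨4 * y, by linarith⟩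
      obtain ⟨u, rfl⟩ := h2
      have h3 : (2 : ℤ) ∣ u := Int.prime_two.dvd_of_dvd_pow (n := 2) ⟨y, by linarith⟩
      obtain ⟨w, rfl⟩ := h3
      exact ⟨w, by ring⟩
  obtain ⟨M, hM, hx⟩ := key
  obtain ⟨a, rfl⟩ := hx _ _ ha
  obtain ⟨b, rfl⟩ := hx _ _ hb
  obtain ⟨c, rfl⟩ := hx _ _ hc
  obtain ⟨d, rfl⟩ := hx _ _ hd
  exact hM ⟨11 * (a * d) - b * c, by rw [h]; ring⟩

theorem shortest_geodesic_normalizer_Gamma0_11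
    (B : SL(2, ℝ))
    (hB : B ∈ Subgroup.normalizer
      (Subgroup.map (Matrix.SpecialLinearGroup.map (Int.castRingHom ℝ))
        (CongruenceSubgroup.Gamma0 11)))
    (hyp : 2 < |Matrix.trace (B : Matrix (Fin 2) (Fin 2) ℝ)|) :
    3 ≤ |Matrix.trace (B : Matrix (Fin 2) (Fin 2) ℝ)| := by
  have hdet := B.det_coe
  rw [Matrix.det_fin_two] at hdet
  obtain ⟨⟨P, hP⟩, ⟨R, hR⟩, ⟨e, he⟩, ⟨Q, hQ⟩, ⟨f, hf⟩⟩ := conj_entries_s9 B hB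
  obtain ⟨⟨S, hS⟩, -, ⟨g, hg⟩, -, ⟨k, hk⟩⟩ := conj_entries_s9 B⁻¹ (inv_mem hB)
  simp [Matrix.SpecialLinearGroup.coe_inv, Matrix.adjugate_fin_two] at hS hg hk
  rw [Matrix.trace_fin_two] at *
  by_contra hlt
  push Not at hlt
  generalize (B 0 0 : ℝ) = p at *
  generalize (B 0 1 : ℝ) = q at *
  generalize (B 1 0 : ℝ) = r at *
  generalize (B 1 1 : ℝ) = s at *
  -- `p * s` is an integer
  obtain ⟨X, hX⟩ : ∃ X : ℤ, (X : ℝ) = p * s := by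
    have hm : ((11 * (P * S) - k * g : ℤ) : ℝ) = 11 * (p * s) := by
      push_cast
      rw [hP, hS, hk, hg]
      linear_combination (11 * p * s) * hdet
    have h2 : (11 * (P * S) - k * g) ^ 2 = 11 * (11 * (P * S)) := by
      have : (((11 * (P * S) - k * g) ^ 2 : ℤ) : ℝ) = ((11 * (11 * (P * S)) : ℤ) : ℝ) := by
        rw [Int.cast_pow, hm]
        push_cast
        rw [hP, hS]
        ring
      exact_mod_cast this
    have h11 : Prime (11 : ℤ) := by norm_num
    obtain ⟨X, hX⟩ := h11.dvd_of_dvd_pow ⟨_, h2⟩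
    refine ⟨X, ?_⟩
    rw [hX] at hm
    push_cast at hm
    linarith
  have hN : ((P + S + 2 * X : ℤ) : ℝ) = (p + s) ^ 2 := by
    push_cast
    rw [hP, hS, hX]
    ring
  have l1 : 4 < P + S + 2 * X := by
    have : (4 : ℝ) < ((P + S + 2 * X : ℤ) : ℝ) := by
      rw [hN, ← sq_abs]
      nlinarith
    exact_mod_cast this
  have l2 : P + S + 2 * X < 9 := by
    have : ((P + S + 2 * X : ℤ) : ℝ) < 9 := by
      rw [hN, ← sq_abs]
      nlinarith
    exact_mod_cast this
  refine no_small (P + S + 2 * X) (P + X) (f - k) (e - g) (S + X) P (11 * Q) R S l1 l2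
    ?_ ?_ ?_ ?_ ?_ <;> rify <;> rw [hP, hS, hX] <;> try rw [hf, hk]
  · ring
  · rw [hQ]; ring
  · rw [he, hg, hR]; ring
  · ring
  · rw [he, hg]
    linear_combination (-11 * (p + s) ^ 2) * hdet
end

section
/- Let G ≤ SL(2,ℝ) be the image of Γ₀(11) ≤ SL(2,ℤ) under the entrywise embedding of SL(2,ℤ) into SL(2,ℝ), and suppose B ∈ SL(2,ℝ) normalizes G with |tr B| > 2. Then for every z in the upper half-plane ℍ, cosh(dist(B • z, z)/2) ≥ 3/2; that is, every hyperbolic element of N(Γ₀(11)) displaces every point of ℍ by at least 2·arccosh(3/2), the length of the geodesic of trace 3. -/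
open Matrix MatrixGroups UpperHalfPlane

lemma aux_not_dvd (ℓ : ℕ) (hℓ : ℓ.Prime) (h11 : ℓ ≠ 11) (t u v w y P S R Q : ℤ) (ht : (ℓ : ℤ) ∣ t)
    (hu : u ^ 2 = t * P) (hv : v ^ 2 = t * S) (hy : y ^ 2 = t * (11 * R)) (hw : 11 * w ^ 2 = t * Q)
    (h : t = u * v - w * y) : (ℓ : ℤ) ^ 2 ∣ t := by
  have hp : Prime (ℓ : ℤ) := Nat.prime_iff_prime_int.mp hℓ
  have h1 : (ℓ : ℤ) ∣ u := hp.dvd_of_dvd_pow (hu ▸ ht.mul_right P)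
  have h2 : (ℓ : ℤ) ∣ v := hp.dvd_of_dvd_pow (hv ▸ ht.mul_right S)
  have h3 : (ℓ : ℤ) ∣ y := hp.dvd_of_dvd_pow (hy ▸ ht.mul_right _)
  have h4 : (ℓ : ℤ) ∣ w := by
    rcases hp.dvd_or_dvd (hw ▸ ht.mul_right Q : (ℓ : ℤ) ∣ 11 * w ^ 2) with h | h
    · exfalso
      have : ℓ ∣ 11 := by exact_mod_cast h
      exact h11 ((Nat.prime_dvd_prime_iff_eq hℓ (by norm_num)).mp this)
    · exact hp.dvd_of_dvd_pow h
  rw [h, pow_two]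
  exact dvd_sub (mul_dvd_mul h1 h2) (mul_dvd_mul h4 h3)

lemma four_dvd_of_sq (u P : ℤ) (h : u ^ 2 = 8 * P) : (4 : ℤ) ∣ u := by
  have h2 : (2 : ℤ) ∣ u := Int.prime_two.dvd_of_dvd_pow (n := 2) ⟨4 * P, by rw [h]; ring⟩
  obtain ⟨a, rfl⟩ := h2
  have h3 : (2 : ℤ) ∣ a := Int.prime_two.dvd_of_dvd_pow (n := 2) ⟨P, by linarith [h, mul_pow 2 a 2]⟩
  obtain ⟨b, rfl⟩ := h3
  exact ⟨b, by ring⟩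

lemma aux_arith_s10 (t u v w y P S R Q : ℤ)
    (hu : u ^ 2 = t * P) (hv : v ^ 2 = t * S) (hy : y ^ 2 = t * (11 * R)) (hw : 11 * w ^ 2 = t * Q)
    (h : t = u * v - w * y) (ht : 4 < t) : 9 ≤ t := by
  by_contra! hlt
  have key := fun ℓ hℓ h11 hd => aux_not_dvd ℓ hℓ h11 t u v w y P S R Q hd hu hv hy hw h
  interval_cases t
  · have := key 5 (by norm_num) (by norm_num) (by norm_num); norm_num at this
  · have := key 3 (by norm_num) (by norm_num) (by norm_num); norm_num at this
  · have := key 7 (by norm_num) (by norm_num) (by norm_num); norm_num at this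
  · obtain ⟨a, rfl⟩ := four_dvd_of_sq u P hu
    obtain ⟨b, rfl⟩ := four_dvd_of_sq v S hv
    obtain ⟨c, rfl⟩ := four_dvd_of_sq y _ hy
    obtain ⟨d, rfl⟩ := four_dvd_of_sq w (3 * Q - 4 * w ^ 2)
      (by linarith)
    have : (8 : ℤ) = 16 * (a * b - d * c) := by linarith
    omega

lemma eleven_dvd (m X : ℤ) (h : m ^ 2 = 11 * X) : (11 : ℤ) ∣ m :=
  (show Prime (11 : ℤ) by exact_mod_cast Nat.prime_iff_prime_int.mp (by norm_num : Nat.Prime 11)).dvd_of_dvd_pow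
    (n := 2) ⟨X, h⟩

lemma aux_real (p q r s : ℝ) (hdet : p * s - q * r = 1) (P k R S l Q m n : ℤ)
    (hP : p ^ 2 = P) (hk : p * r = k) (hR : r ^ 2 = 11 * R) (hS : s ^ 2 = S) (hl : s * r = l)
    (hQ : 11 * q ^ 2 = Q) (hm : 11 * (q * s) = m) (hn : 11 * (p * q) = n)
    (ht : 4 < (p + s) ^ 2) : 9 ≤ (p + s) ^ 2 := by
  have hm2 : m ^ 2 = 11 * (Q * S) := by
    have : (m : ℝ) ^ 2 = 11 * (Q * S) := by rw [← hm, ← hQ, ← hS]; ring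
    exact_mod_cast this
  have hn2 : n ^ 2 = 11 * (Q * P) := by
    have : (n : ℝ) ^ 2 = 11 * (Q * P) := by rw [← hn, ← hQ, ← hP]; ring
    exact_mod_cast this
  obtain ⟨m', rfl⟩ := eleven_dvd _ _ hm2
  obtain ⟨n', rfl⟩ := eleven_dvd _ _ hn2
  have hm' : q * s = m' := by push_cast at hm; linarith
  have hn' : p * q = n' := by push_cast at hn; linarith
  have hx : p * s = ((P * S - k * m' : ℤ) : ℝ) := by
    push_cast
    rw [← hP, ← hS, ← hk, ← hm']
    linear_combination p * s * (-hdet)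
  generalize P * S - k * m' = x at hx
  have htt : (p + s) ^ 2 = ((P + S + 2 * x : ℤ) : ℝ) := by
    push_cast; rw [← hP, ← hS, ← hx]; ring
  have h4 : 4 < P + S + 2 * x := by rw [htt] at ht; exact_mod_cast ht
  rw [htt]
  have := aux_arith_s10 (P + S + 2 * x) (P + x) (S + x) (n' + m') (k + l) P S R Q
    (by
      have : ((P : ℝ) + x) ^ 2 = (P + S + 2 * x) * P := by
        rw [← hP, ← hS, ← hx]; ring
      exact_mod_cast this)
    (by
      have : ((S : ℝ) + x) ^ 2 = (P + S + 2 * x) * S := by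
        rw [← hP, ← hS, ← hx]; ring
      exact_mod_cast this)
    (by
      have : ((k : ℝ) + l) ^ 2 = (P + S + 2 * x) * (11 * R) := by
        rw [← hP, ← hS, ← hx, ← hR, ← hk, ← hl]; ring
      exact_mod_cast this)
    (by
      have : 11 * ((n' : ℝ) + m') ^ 2 = (P + S + 2 * x) * Q := by
        rw [← hP, ← hS, ← hx, ← hQ, ← hn', ← hm']; ring
      exact_mod_cast this)
    (by
      have : ((P : ℝ) + S + 2 * x) = (P + x) * (S + x) - (n' + m') * (k + l) := by
        rw [← hP, ← hS, ← hx, ← hn', ← hm', ← hk, ← hl]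
        linear_combination (-(p + s) ^ 2) * hdet
      exact_mod_cast this) h4
  exact_mod_cast this

lemma cosh_displacement (B : SL(2, ℝ)) (z : ℍ) :
    |B 0 0 + B 1 1| / 2 ≤ Real.cosh (dist (B • z) z / 2) := by
  have hd := B.det_coe
  rw [Matrix.det_fin_two] at hd
  have hz := z.im_pos
  set g : GL (Fin 2) ℝ := (B : GL (Fin 2) ℝ) with hg
  have hD : (B 1 0 : ℂ) * z + B 1 1 ≠ 0 := UpperHalfPlane.denom_ne_zero g z
  have hc : ((B • z : ℍ) : ℂ) = (B 0 0 * z + B 0 1) / (B 1 0 * z + B 1 1) := by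
    simpa using UpperHalfPlane.coe_specialLinearGroup_apply B z
  have him : (B • z).im = z.im / Complex.normSq (B 1 0 * z + B 1 1) := by
    have := UpperHalfPlane.im_smul_eq_div_normSq g z
    have hdet : |g.det.val| = 1 := by simp [hg]
    rw [hdet, one_mul] at this
    exact this
  rw [UpperHalfPlane.cosh_half_dist, him, hc, Complex.dist_eq]
  set D : ℂ := (B 1 0 : ℂ) * z + B 1 1 with hDdef
  have hN : 0 < ‖D‖ := norm_pos_iff.mpr hD
  rw [Complex.normSq_eq_norm_sq]
  have hs : √(z.im / ‖D‖ ^ 2 * z.im) = z.im / ‖D‖ := by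
    rw [show z.im / ‖D‖ ^ 2 * z.im = (z.im / ‖D‖) ^ 2 by ring]
    exact Real.sqrt_sq (by positivity)
  rw [hs]
  set W : ℂ := ((B 0 0 : ℂ) * (z : ℂ) + (B 0 1 : ℂ)) - (starRingEnd ℂ) (z : ℂ) * D with hW
  have e : ((B 0 0 : ℂ) * (z : ℂ) + (B 0 1 : ℂ)) / D - (starRingEnd ℂ) (z : ℂ) = W / D := by
    rw [hW]; field_simp
  have hWim : W.im = (B 0 0 + B 1 1) * z.im := by
    simp [hW, hDdef]; ring
  rw [e, norm_div]
  have hle : |B 0 0 + B 1 1| * z.im ≤ ‖W‖ := by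
    have := Complex.abs_im_le_norm W
    rwa [hWim, abs_mul, abs_of_pos hz] at this
  rw [show ‖W‖ / ‖D‖ / (2 * (z.im / ‖D‖)) = ‖W‖ / (2 * z.im) by field_simp]
  rw [div_le_div_iff₀ (by norm_num) (by positivity)]
  linarith

abbrev G11 : Subgroup SL(2, ℝ) := Subgroup.map (Matrix.SpecialLinearGroup.map (Int.castRingHom ℝ))
        (CongruenceSubgroup.Gamma0 11)

lemma mem_G11 (g : SL(2, ℝ)) (h : g ∈ G11) : ∃ a b c d : ℤ, g 0 0 = a ∧ g 0 1 = b ∧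
    g 1 0 = 11 * c ∧ g 1 1 = d := by
  obtain ⟨γ, hγ, rfl⟩ := h
  have h0 : ((γ 1 0 : ℤ) : ZMod 11) = 0 := CongruenceSubgroup.Gamma0_mem.mp hγ
  obtain ⟨c, hc⟩ := (ZMod.intCast_zmod_eq_zero_iff_dvd _ _).mp h0
  refine ⟨γ 0 0, γ 0 1, c, γ 1 1, by simp, by simp, ?_, by simp⟩
  have : (Matrix.SpecialLinearGroup.map (Int.castRingHom ℝ) γ) 1 0 = ((γ 1 0 : ℤ) : ℝ) := by simp
  rw [this, hc]; push_cast; ring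

lemma map_entry (γ : SL(2, ℤ)) (i j : Fin 2) :
    (Matrix.SpecialLinearGroup.map (Int.castRingHom ℝ) γ) i j = ((γ i j : ℤ) : ℝ) := by simp

def Tz : SL(2, ℤ) := ⟨!![1, 1; 0, 1], by simp [Matrix.det_fin_two]⟩
def Uz : SL(2, ℤ) := ⟨!![1, 0; 11, 1], by simp [Matrix.det_fin_two]⟩

lemma Tz_mem : Tz ∈ CongruenceSubgroup.Gamma0 11 := by
  rw [CongruenceSubgroup.Gamma0_mem]; simp [Tz]

lemma Uz_mem : Uz ∈ CongruenceSubgroup.Gamma0 11 := by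
  rw [CongruenceSubgroup.Gamma0_mem]; simp only [Uz]; decide

lemma exists_T : ∃ T ∈ G11, T 0 0 = 1 ∧ T 0 1 = 1 ∧ T 1 0 = 0 ∧ T 1 1 = 1 :=
  ⟨_, ⟨Tz, Tz_mem, rfl⟩, by erw [map_entry]; simp [Tz], by erw [map_entry]; simp [Tz],
    by erw [map_entry]; simp [Tz], by erw [map_entry]; simp [Tz]⟩

lemma exists_U : ∃ T ∈ G11, T 0 0 = 1 ∧ T 0 1 = 0 ∧ T 1 0 = 11 ∧ T 1 1 = 1 :=
  ⟨_, ⟨Uz, Uz_mem, rfl⟩, by erw [map_entry]; simp [Uz], by erw [map_entry]; simp [Uz],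
    by erw [map_entry]; simp [Uz], by erw [map_entry]; simp [Uz]⟩

lemma integrality (B : SL(2, ℝ)) (hB : B ∈ Subgroup.normalizer (G11 : Set SL(2, ℝ))) :
    ∃ P k R S m Q : ℤ, (B 0 0) ^ 2 = P ∧ B 0 0 * B 1 0 = k ∧ (B 1 0) ^ 2 = 11 * R ∧
      (B 1 1) ^ 2 = S ∧ 11 * (B 0 1 * B 1 1) = m ∧ 11 * (B 0 1) ^ 2 = Q := by
  have hd := B.det_coe
  rw [Matrix.det_fin_two] at hd
  rw [Subgroup.mem_normalizer_iff] at hB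
  obtain ⟨T, hT, t1, t2, t3, t4⟩ := exists_T
  obtain ⟨U, hU, u1, u2, u3, u4⟩ := exists_U
  obtain ⟨a, b, c, d, ha, hb, hc, -⟩ := mem_G11 _ ((hB _).mp hT)
  obtain ⟨a', b', c', d', ha', hb', hc', -⟩ := mem_G11 _ ((hB _).mp hU)
  simp [Matrix.mul_apply, Fin.sum_univ_two, Matrix.SpecialLinearGroup.coe_mul,
    Matrix.SpecialLinearGroup.coe_inv, Matrix.adjugate_fin_two, t1, t2, t3, t4] at ha hb hc
  simp [Matrix.mul_apply, Fin.sum_univ_two, Matrix.SpecialLinearGroup.coe_mul,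
    Matrix.SpecialLinearGroup.coe_inv, Matrix.adjugate_fin_two, u1, u2, u3, u4] at ha' hb' hc'
  refine ⟨b, 1 - a, -c, c', a' - 1, -b', ?_, ?_, ?_, ?_, ?_, ?_⟩ <;> push_cast
  · linarith
  · linarith
  · linarith
  · linarith
  · linarith
  · linarith

theorem displacement_bound_normalizer_Gamma0_11
    (B : SL(2, ℝ))
    (hB : B ∈ Subgroup.normalizer
      (Subgroup.map (Matrix.SpecialLinearGroup.map (Int.castRingHom ℝ))
        (CongruenceSubgroup.Gamma0 11)))
    (hyp : 2 < |Matrix.trace (B : Matrix (Fin 2) (Fin 2) ℝ)|) :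
    ∀ z : ℍ, (3 : ℝ) / 2 ≤ Real.cosh (dist (B • z) z / 2) := by
  intro z
  refine le_trans ?_ (cosh_displacement B z)
  rw [Matrix.trace_fin_two] at hyp
  have hd := B.det_coe
  rw [Matrix.det_fin_two] at hd
  obtain ⟨P, k, R, S, m, Q, hP, hk, hR, hS, hm, hQ⟩ := integrality B hB
  obtain ⟨P', k', R', S', m', Q', hP', hk', hR', hS', hm', hQ'⟩ :=
    integrality B⁻¹ (inv_mem hB)
  simp [Matrix.SpecialLinearGroup.SL2_inv_expl] at hk' hm'
  have h9 := aux_real (B 0 0) (B 0 1) (B 1 0) (B 1 1) hd P k R S (-k') Q m (-m')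
    hP hk hR hS (by push_cast; linarith) hQ hm (by push_cast; linarith)
    (by rw [← sq_abs]; nlinarith)
  have : 3 ≤ |B 0 0 + B 1 1| := by
    apply abs_le_of_sq_le_sq' _ (abs_nonneg _) |>.2
    rw [sq_abs]; linarith
  linarith
end

section
/- Let ℓ, a, b be real numbers with 0 < ℓ, 0 < a, a ≤ b, and a·(b − a) ≤ 2·ℓ². Let s₀ = arsinh((b − a)/(2ℓ)). Then for every s ≥ 0 with ℓ·sinh(s) < b, one has max( ℓ·cosh(s)/(a + ℓ·sinh(s)), ℓ·cosh(s)/(b − ℓ·sinh(s)) ) ≥ ℓ·cosh(s₀)/(a + ℓ·sinh(s₀)); that is, the maximum of the two isoperimetric ratios h*(A_s) = ℓ·cosh(s)/(a + ℓ·sinh(s)) and h*(B_s) = ℓ·cosh(s)/(b − ℓ·sinh(s)) is minimized at the value s₀ where the two ratios are equal. -/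
open Real

theorem le_of_sq_le_sq_aux {p q : ℝ} (h : p ^ 2 ≤ q ^ 2) (hq : 0 ≤ q) : p ≤ q :=
  abs_le_of_sq_le_sq' h hq |>.2

theorem equidistant_ratio_minimized_at_equal_ratios
    (ℓ a b : ℝ) (hℓ : 0 < ℓ) (ha : 0 < a) (hab : a ≤ b)
    (hmin : a * (b - a) ≤ 2 * ℓ ^ 2) :
    ∀ s : ℝ, 0 ≤ s → ℓ * Real.sinh s < b →
      ℓ * Real.cosh (Real.arsinh ((b - a) / (2 * ℓ))) /
          (a + ℓ * Real.sinh (Real.arsinh ((b - a) / (2 * ℓ)))) ≤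
        max (ℓ * Real.cosh s / (a + ℓ * Real.sinh s))
            (ℓ * Real.cosh s / (b - ℓ * Real.sinh s)) := by
  intro s hs hsb
  set t := Real.arsinh ((b - a) / (2 * ℓ)) with ht
  have hy : Real.sinh t = (b - a) / (2 * ℓ) := Real.sinh_arsinh _
  have hx0 : 0 ≤ Real.sinh s := Real.sinh_nonneg_iff.2 hs
  have hy0 : 0 ≤ Real.sinh t := by
    rw [hy]; exact div_nonneg (by linarith) (by linarith)
  have hly : 2 * (ℓ * Real.sinh t) = b - a := by
    rw [hy]; field_simp
  have ct := Real.cosh_sq t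
  have cs := Real.cosh_sq s
  have pt := Real.cosh_pos t
  have ps := Real.cosh_pos s
  have hay : a * Real.sinh t ≤ ℓ := by
    rw [← hly] at hmin
    have : ℓ * (a * Real.sinh t) ≤ ℓ * ℓ := by nlinarith
    exact le_of_mul_le_mul_left this hℓ
  generalize Real.sinh t = y at *
  generalize Real.sinh s = x at *
  generalize Real.cosh t = c at *
  generalize Real.cosh s = d at *
  have hlx0 : 0 ≤ ℓ * x := by positivity
  have hly0 : 0 ≤ ℓ * y := by positivity
  have hA : 0 < a + ℓ * x := by linarith
  have hA' : 0 < a + ℓ * y := by linarith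
  rcases le_total x y with h | h
  · refine le_trans ?_ (le_max_left _ _)
    rw [div_le_div_iff₀ hA' hA]
    have hax : a * x ≤ ℓ := le_trans (mul_le_mul_of_nonneg_left h ha.le) hay
    have key : 0 ≤ (y - x) * ((ℓ - a * y) * (a + ℓ * x) + (ℓ - a * x) * (a + ℓ * y)) :=
      mul_nonneg (by linarith) (add_nonneg (mul_nonneg (by linarith) hA.le)
        (mul_nonneg (by linarith) hA'.le))
    have h2 : c * (a + ℓ * x) ≤ d * (a + ℓ * y) := by
      apply le_of_sq_le_sq_aux _ (by positivity)
      rw [mul_pow, mul_pow, ct, cs]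
      linarith
    calc ℓ * c * (a + ℓ * x) = ℓ * (c * (a + ℓ * x)) := by ring
      _ ≤ ℓ * (d * (a + ℓ * y)) := mul_le_mul_of_nonneg_left h2 hℓ.le
      _ = _ := by ring
  · refine le_trans ?_ (le_max_right _ _)
    have hcd : c ≤ d := by
      apply le_of_sq_le_sq_aux _ ps.le
      rw [ct, cs]; nlinarith
    have hl : ℓ * y ≤ ℓ * x := mul_le_mul_of_nonneg_left h hℓ.le
    apply div_le_div₀ (by positivity) (mul_le_mul_of_nonneg_left hcd hℓ.le) (by linarith)
    linarith
end

section
/- Let S ⊂ SL(2,ℝ) consist of the seven matrices γ₁ = (1, 1; 0, 1), γ₃ = (√19, 9/√19; 2√19, √19), γ₄ = (√19, 6/√19; 3√19, √19), (39, 10; 152, 39), (37, 9; 152, 37), (7√19, 31/√19; 30√19, 7√19), and (0, −1/√19; √19, 0), and let Γ' be the subgroup of SL(2,ℝ) generated by S. Then the trace-zero element γ₅ = (−√19, −5/√19; 4√19, √19) ∈ SL(2,ℝ) normalizes Γ': for every g ∈ Γ', γ₅⁻¹·g·γ₅ ∈ Γ'. -/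
open Matrix MatrixGroups

theorem involution_normalizes_rotation_subgroup_19
    (g₁ g₃ g₄ g₅₅ g₁₅ g₃₅ g₄₅ γ₅ : SL(2, ℝ))
    (h₁ : (g₁ : Matrix (Fin 2) (Fin 2) ℝ) = !![1, 1; 0, 1])
    (h₃ : (g₃ : Matrix (Fin 2) (Fin 2) ℝ) =
      !![Real.sqrt 19, 9 / Real.sqrt 19; 2 * Real.sqrt 19, Real.sqrt 19])
    (h₄ : (g₄ : Matrix (Fin 2) (Fin 2) ℝ) =
      !![Real.sqrt 19, 6 / Real.sqrt 19; 3 * Real.sqrt 19, Real.sqrt 19])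
    (h₅₅ : (g₅₅ : Matrix (Fin 2) (Fin 2) ℝ) = !![39, 10; 152, 39])
    (h₁₅ : (g₁₅ : Matrix (Fin 2) (Fin 2) ℝ) = !![37, 9; 152, 37])
    (h₃₅ : (g₃₅ : Matrix (Fin 2) (Fin 2) ℝ) =
      !![7 * Real.sqrt 19, 31 / Real.sqrt 19; 30 * Real.sqrt 19, 7 * Real.sqrt 19])
    (h₄₅ : (g₄₅ : Matrix (Fin 2) (Fin 2) ℝ) =
      !![0, -1 / Real.sqrt 19; Real.sqrt 19, 0])
    (hγ₅ : (γ₅ : Matrix (Fin 2) (Fin 2) ℝ) =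
      !![-Real.sqrt 19, -5 / Real.sqrt 19; 4 * Real.sqrt 19, Real.sqrt 19]) :
    ∀ g ∈ Subgroup.closure {g₁, g₃, g₄, g₅₅, g₁₅, g₃₅, g₄₅},
      γ₅⁻¹ * g * γ₅ ∈ Subgroup.closure {g₁, g₃, g₄, g₅₅, g₁₅, g₃₅, g₄₅} := by
  have hpos : Real.sqrt 19 ≠ 0 := by positivity
  have hsq : Real.sqrt 19 ^ 2 = 19 := Real.sq_sqrt (by norm_num)
  have hinj : ∀ a b : SL(2, ℝ), (a : Matrix (Fin 2) (Fin 2) ℝ) = (b : Matrix (Fin 2) (Fin 2) ℝ) →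
      a = b := fun a b h => Subtype.ext h
  have hmul : ∀ a b : SL(2, ℝ), ((a * b : SL(2, ℝ)) : Matrix (Fin 2) (Fin 2) ℝ) =
      (a : Matrix (Fin 2) (Fin 2) ℝ) * (b : Matrix (Fin 2) (Fin 2) ℝ) := fun a b => rfl
  have hinv : ∀ a : SL(2, ℝ), ((a⁻¹ : SL(2, ℝ)) : Matrix (Fin 2) (Fin 2) ℝ) =
      adjugate (a : Matrix (Fin 2) (Fin 2) ℝ) := fun a => rfl
  set K := Subgroup.closure {g₁, g₃, g₄, g₅₅, g₁₅, g₃₅, g₄₅} with hK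
  have m₁ : g₁ ∈ K := Subgroup.subset_closure (by simp)
  have m₃ : g₃ ∈ K := Subgroup.subset_closure (by simp)
  have m₄ : g₄ ∈ K := Subgroup.subset_closure (by simp)
  have m₅₅ : g₅₅ ∈ K := Subgroup.subset_closure (by simp)
  have m₁₅ : g₁₅ ∈ K := Subgroup.subset_closure (by simp)
  have m₃₅ : g₃₅ ∈ K := Subgroup.subset_closure (by simp)
  have m₄₅ : g₄₅ ∈ K := Subgroup.subset_closure (by simp)
  have e₁ : γ₅⁻¹ * g₁ * γ₅ = g₄₅ * g₄₅ * (g₅₅⁻¹ * g₁₅) := by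
    apply hinj
    simp only [hmul, hinv, hγ₅, h₁, h₄₅, h₅₅, h₁₅,
      adjugate_fin_two_of, mul_fin_two]
    ext i j
    fin_cases i <;> fin_cases j <;> simp <;> field_simp <;> (try simp only [hsq]) <;>
      (try norm_num) <;>
      grind
  have e₃ : γ₅⁻¹ * g₃ * γ₅ = g₄₅ * g₄₅ * (g₅₅⁻¹ * g₃₅) := by
    apply hinj
    simp only [hmul, hinv, hγ₅, h₃, h₄₅, h₅₅, h₃₅,
      adjugate_fin_two_of, mul_fin_two]
    ext i j
    fin_cases i <;> fin_cases j <;> simp <;> field_simp <;> (try simp only [hsq]) <;>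
      (try norm_num) <;>
      grind
  have e₄ : γ₅⁻¹ * g₄ * γ₅ = g₅₅⁻¹ * g₄₅⁻¹ := by
    apply hinj
    simp only [hmul, hinv, hγ₅, h₄, h₅₅, h₄₅,
      adjugate_fin_two_of, mul_fin_two]
    ext i j
    fin_cases i <;> fin_cases j <;> simp <;> field_simp <;> (try simp only [hsq]) <;>
      (try norm_num) <;>
      grind
  have e₅₅ : γ₅⁻¹ * g₅₅ * γ₅ = g₅₅⁻¹ := by
    apply hinj
    simp only [hmul, hinv, hγ₅, h₅₅,
      adjugate_fin_two_of, mul_fin_two]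
    ext i j
    fin_cases i <;> fin_cases j <;> simp <;> field_simp <;> (try simp only [hsq]) <;>
      (try norm_num) <;>
      grind
  have e₁₅ : γ₅⁻¹ * g₁₅ * γ₅ = g₄₅ * g₄₅ * (g₅₅⁻¹ * g₁) := by
    apply hinj
    simp only [hmul, hinv, hγ₅, h₁₅, h₄₅, h₅₅, h₁,
      adjugate_fin_two_of, mul_fin_two]
    ext i j
    fin_cases i <;> fin_cases j <;> simp <;> field_simp <;> (try simp only [hsq]) <;>
      (try norm_num) <;>
      grind
  have e₃₅ : γ₅⁻¹ * g₃₅ * γ₅ = g₄₅ * g₄₅ * (g₅₅⁻¹ * g₃) := by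
    apply hinj
    simp only [hmul, hinv, hγ₅, h₃₅, h₄₅, h₅₅, h₃,
      adjugate_fin_two_of, mul_fin_two]
    ext i j
    fin_cases i <;> fin_cases j <;> simp <;> field_simp <;> (try simp only [hsq]) <;>
      (try norm_num) <;>
      grind
  have e₄₅ : γ₅⁻¹ * g₄₅ * γ₅ = g₄⁻¹ * g₅₅ := by
    apply hinj
    simp only [hmul, hinv, hγ₅, h₄₅, h₄, h₅₅,
      adjugate_fin_two_of, mul_fin_two]
    ext i j
    fin_cases i <;> fin_cases j <;> simp <;> field_simp <;> (try simp only [hsq]) <;>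
      (try norm_num) <;>
      grind
  intro g hg
  induction hg using Subgroup.closure_induction with
  | mem x hx =>
    simp only [Set.mem_insert_iff, Set.mem_singleton_iff] at hx
    have mm : g₄₅ * g₄₅ ∈ K := K.mul_mem m₄₅ m₄₅
    have mi : g₅₅⁻¹ ∈ K := K.inv_mem m₅₅
    rcases hx with rfl | rfl | rfl | rfl | rfl | rfl | rfl
    · rw [e₁]; exact K.mul_mem mm (K.mul_mem mi m₁₅)
    · rw [e₃]; exact K.mul_mem mm (K.mul_mem mi m₃₅)
    · rw [e₄]; exact K.mul_mem mi (K.inv_mem m₄₅)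
    · rw [e₅₅]; exact mi
    · rw [e₁₅]; exact K.mul_mem mm (K.mul_mem mi m₁)
    · rw [e₃₅]; exact K.mul_mem mm (K.mul_mem mi m₃)
    · rw [e₄₅]; exact K.mul_mem (K.inv_mem m₄) m₅₅
  | one => simp
  | mul x y _ _ hx hy =>
    have : γ₅⁻¹ * (x * y) * γ₅ = (γ₅⁻¹ * x * γ₅) * (γ₅⁻¹ * y * γ₅) := by group
    rw [this]; exact K.mul_mem hx hy
  | inv x _ hx =>
    have : γ₅⁻¹ * x⁻¹ * γ₅ = (γ₅⁻¹ * x * γ₅)⁻¹ := by group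
    rw [this]; exact K.inv_mem hx
end

section
/- Let S ⊂ SL(2,ℝ) consist of the seven matrices γ₁ = (1, 1; 0, 1), γ₃ = (√19, 9/√19; 2√19, √19), γ₄ = (√19, 6/√19; 3√19, √19), (39, 10; 152, 39), (37, 9; 152, 37), (7√19, 31/√19; 30√19, 7√19), and (0, −1/√19; √19, 0), and let Γ' be the subgroup of SL(2,ℝ) generated by S. Let J denote the matrix diag(−1, 1) (the reflection γ₇, of determinant −1). Then conjugation by J preserves Γ': for every g ∈ Γ' there exists h ∈ Γ' whose underlying matrix equals J·g·J. -/
open Matrix MatrixGroups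

theorem reflection_normalizes_rotation_subgroup_19
    (g₁ g₃ g₄ g₅₅ g₁₅ g₃₅ g₄₅ : SL(2, ℝ))
    (h₁ : (g₁ : Matrix (Fin 2) (Fin 2) ℝ) = !![1, 1; 0, 1])
    (h₃ : (g₃ : Matrix (Fin 2) (Fin 2) ℝ) =
      !![Real.sqrt 19, 9 / Real.sqrt 19; 2 * Real.sqrt 19, Real.sqrt 19])
    (h₄ : (g₄ : Matrix (Fin 2) (Fin 2) ℝ) =
      !![Real.sqrt 19, 6 / Real.sqrt 19; 3 * Real.sqrt 19, Real.sqrt 19])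
    (h₅₅ : (g₅₅ : Matrix (Fin 2) (Fin 2) ℝ) = !![39, 10; 152, 39])
    (h₁₅ : (g₁₅ : Matrix (Fin 2) (Fin 2) ℝ) = !![37, 9; 152, 37])
    (h₃₅ : (g₃₅ : Matrix (Fin 2) (Fin 2) ℝ) =
      !![7 * Real.sqrt 19, 31 / Real.sqrt 19; 30 * Real.sqrt 19, 7 * Real.sqrt 19])
    (h₄₅ : (g₄₅ : Matrix (Fin 2) (Fin 2) ℝ) =
      !![0, -1 / Real.sqrt 19; Real.sqrt 19, 0]) :
    ∀ g ∈ Subgroup.closure {g₁, g₃, g₄, g₅₅, g₁₅, g₃₅, g₄₅},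
      ∃ h ∈ Subgroup.closure {g₁, g₃, g₄, g₅₅, g₁₅, g₃₅, g₄₅},
        (h : Matrix (Fin 2) (Fin 2) ℝ) =
          !![(-1 : ℝ), 0; 0, 1] * (g : Matrix (Fin 2) (Fin 2) ℝ) *
            !![(-1 : ℝ), 0; 0, 1] := by
  intro g hg
  have hJ : !![(-1 : ℝ), 0; 0, 1] * !![(-1 : ℝ), 0; 0, 1] = 1 := by
    ext i j; fin_cases i <;> fin_cases j <;> simp
  -- a matrix with equal diagonal entries is conjugated by `J` to its adjugate
  have key : ∀ x : SL(2, ℝ), (x : Matrix (Fin 2) (Fin 2) ℝ) 0 0 = x 1 1 →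
      ((x⁻¹ : SL(2, ℝ)) : Matrix (Fin 2) (Fin 2) ℝ) =
        !![(-1 : ℝ), 0; 0, 1] * (x : Matrix (Fin 2) (Fin 2) ℝ) * !![(-1 : ℝ), 0; 0, 1] := by
    intro x hx
    rw [Matrix.SpecialLinearGroup.coe_inv, Matrix.adjugate_fin_two]
    ext i j
    fin_cases i <;> fin_cases j <;> simp [Matrix.mul_apply, Matrix.vecMul, dotProduct, Fin.sum_univ_two, hx]
  induction hg using Subgroup.closure_induction with
  | mem x hx =>
    refine ⟨x⁻¹, inv_mem (Subgroup.subset_closure hx), key x ?_⟩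
    simp only [Set.mem_insert_iff, Set.mem_singleton_iff] at hx
    rcases hx with rfl | rfl | rfl | rfl | rfl | rfl | rfl
    · simp [h₁]
    · simp [h₃]
    · simp [h₄]
    · simp [h₅₅]
    · simp [h₁₅]
    · simp [h₃₅]
    · simp [h₄₅]
  | one => exact ⟨1, one_mem _, by simp [hJ]⟩
  | mul x y _ _ hx hy =>
    obtain ⟨a, ha, ha'⟩ := hx
    obtain ⟨b, hb, hb'⟩ := hy
    refine ⟨a * b, mul_mem ha hb, ?_⟩
    rw [Matrix.SpecialLinearGroup.coe_mul, Matrix.SpecialLinearGroup.coe_mul, ha', hb']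
    generalize !![(-1 : ℝ), 0; 0, 1] = J at hJ
    calc _ = J * (x : Matrix (Fin 2) (Fin 2) ℝ) * (J * J) * y * J := by
          simp only [Matrix.mul_assoc]
      _ = _ := by rw [hJ]; simp only [Matrix.mul_assoc, Matrix.one_mul]
  | inv x _ hx =>
    obtain ⟨a, ha, ha'⟩ := hx
    refine ⟨a⁻¹, inv_mem ha, ?_⟩
    rw [Matrix.SpecialLinearGroup.coe_inv, Matrix.SpecialLinearGroup.coe_inv, ha',
      Matrix.adjugate_fin_two, Matrix.adjugate_fin_two]
    ext i j
    fin_cases i <;> fin_cases j <;> simp [Matrix.mul_apply, Matrix.vecMul, dotProduct, Fin.sum_univ_two]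
end
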